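/- Suppose W, Z ⊆ ℕ satisfy W ≰_T Z, n ∈ ℕ, and f : [ℕ]^{n+4} → ℕ is a 2-bounded coloring computable relative to an oracle for Z. Then there exists an infinite 3-tail f-rainbow X such that W ≰_T X ⊕ Z. -/

import Mathlib

namespace RRT

/-- Partial functions on ℕ that are recursive in the oracle `O`.
This mirrors `Nat.Partrec`, with an extra constructor for the oracle. -/
inductive RecursiveIn (O : ℕ →. ℕ) : (ℕ →. ℕ) → Prop
  | zero : RecursiveIn O (pure 0)
  | succ : RecursiveIn O Nat.succ
  | left : RecursiveIn O ↑fun n : ℕ => n.unpair.1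
  | right : RecursiveIn O ↑fun n : ℕ => n.unpair.2
  | oracle : RecursiveIn O O
  | pair {f g} : RecursiveIn O f → RecursiveIn O g →
      RecursiveIn O fun n => Nat.pair <$> f n <*> g n
  | comp {f g} : RecursiveIn O f → RecursiveIn O g →
      RecursiveIn O fun n => g n >>= f
  | prec {f g} : RecursiveIn O f → RecursiveIn O g →
      RecursiveIn O (Nat.unpaired fun a n =>
        n.rec (f a) fun y IH => do let i ← IH; g (Nat.pair a (Nat.pair y i)))
  | rfind {f} : RecursiveIn O f →
      RecursiveIn O fun a => Nat.rfind fun n => (fun m => m = 0) <$> f (Nat.pair a n)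

/-- The characteristic function of a set of naturals. -/
noncomputable def chi (A : Set ℕ) : ℕ → ℕ := A.indicator fun _ => 1

/-- Turing reducibility `A ≤_T B` for sets of naturals: the characteristic function of `A`
is computable relative to an oracle for the characteristic function of `B`. -/
def TuringLE (A B : Set ℕ) : Prop := RecursiveIn (chi B) (chi A)

/-- The recursive join `A ⊕ B = {2n : n ∈ A} ∪ {2n+1 : n ∈ B}`. -/
def join (A B : Set ℕ) : Set ℕ :=
  {n : ℕ | (∃ m ∈ A, n = 2 * m) ∨ (∃ m ∈ B, n = 2 * m + 1)}

/-- A total function `f : ℕ → ℕ` is computable relative to an oracle for `Z ⊆ ℕ`. -/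
def FunRecIn (Z : Set ℕ) (f : ℕ → ℕ) : Prop := RecursiveIn (chi Z) f


/-- A coloring of `[ℕ]^k` (identified with strictly increasing `k`-tuples) is 2-bounded
if every color has at most 2 preimages. -/
def Bounded2Tuples (k : ℕ) (f : (Fin k → ℕ) → ℕ) : Prop :=
  ∀ c : ℕ, {s : Fin k → ℕ | StrictMono s ∧ f s = c}.encard ≤ 2

open Classical in
/-- initial segment of length `l` of the characteristic sequence of `O` -/
noncomputable def pre (O : Set ℕ) (l : ℕ) : List Bool := (List.range l).map (fun i => decide (i ∈ O))

/-- relation uniformly c.e. in the oracles `o i` -/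
def Sg {ι α : Type*} [Primcodable α] (o : ι → Set ℕ) (V : ι → α → Prop) : Prop :=
  ∃ T : List Bool × α → Prop, PrimrecPred T ∧ ∀ i a, V i a ↔ ∃ l, T (pre (o i) l, a)

theorem pre_length (O : Set ℕ) (l : ℕ) : (pre O l).length = l := by simp [pre]

theorem pre_take (O : Set ℕ) (k l : ℕ) (h : k ≤ l) : (pre O l).take k = pre O k := by
  simp [pre, ← List.map_take, List.take_range, Nat.min_eq_left h]

theorem pre_getElem? (O : Set ℕ) (l i : ℕ) (b : Bool) :
    (pre O l)[i]? = some b ↔ i < l ∧ (b = true ↔ i ∈ O) := by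
  classical
  unfold pre
  rw [List.getElem?_map]
  by_cases h : i < l
  · simp only [List.getElem?_range h, Option.map_some, Option.some.injEq, h, true_and]
    cases b <;> simp
  · simp [h]

theorem pre_congr {O O' : Set ℕ} {l : ℕ} (h : ∀ i < l, i ∈ O ↔ i ∈ O') : pre O l = pre O' l := by
  classical
  unfold pre
  apply List.map_congr_left
  intro i hi
  simp [h i (List.mem_range.1 hi)]

section closure
variable {ι : Type*} {o : ι → Set ℕ} {α β γ : Type} [Primcodable α] [Primcodable β] [Primcodable γ]

/-- Monotone version. -/
theorem Sg.mono {V : ι → α → Prop} (h : Sg o V) : ∃ T : List Bool × α → Prop, PrimrecPred T ∧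
    (∀ i a, V i a ↔ ∃ l, T (pre (o i) l, a)) ∧
    (∀ O a l l', l ≤ l' → T (pre O l, a) → T (pre O l', a)) := by
  obtain ⟨T, hT, hV⟩ := h
  refine ⟨fun p => ∃ k ∈ List.range (p.1.length + 1), T (p.1.take k, p.2), ?_, ?_, ?_⟩
  · have h1 : PrimrecRel (fun (k : ℕ) (p : List Bool × α) => T (p.1.take k, p.2)) := by
      refine hT.comp (f := fun q : ℕ × (List Bool × α) => (q.2.1.take q.1, q.2.2)) ?_
      exact (Primrec.list_take.comp Primrec.fst (Primrec.fst.comp Primrec.snd)).pair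
        (Primrec.snd.comp Primrec.snd)
    exact h1.exists_mem_list.comp (Primrec.list_range.comp
      (Primrec.succ.comp (Primrec.list_length.comp Primrec.fst))) Primrec.id
  · intro i a
    rw [hV]
    constructor
    · rintro ⟨l, hl⟩
      exact ⟨l, l, by simp [pre_length], by simpa [pre_take] using hl⟩
    · rintro ⟨l, k, hk, h⟩
      simp only [pre_length, List.mem_range] at hk h
      exact ⟨k, by rwa [pre_take _ _ _ (by omega)] at h⟩
  · rintro O a l l' hl ⟨k, hk, h⟩
    simp only [pre_length, List.mem_range] at hk h ⊢
    refine ⟨k, by omega, ?_⟩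
    rwa [pre_take _ _ _ (by omega)] at h ⊢

theorem Sg.of_eq {V V' : ι → α → Prop} (h : Sg o V) (e : ∀ i a, V i a ↔ V' i a) : Sg o V' := by
  obtain ⟨T, hT, hV⟩ := h
  exact ⟨T, hT, fun i a => by rw [← e, hV]⟩

theorem Sg.prim {p : α → Prop} (h : PrimrecPred p) : Sg o (fun _ a => p a) :=
  ⟨fun q => p q.2, h.comp Primrec.snd, fun _ _ => by simp⟩

theorem Sg.and {V V' : ι → α → Prop} (h : Sg o V) (h' : Sg o V') :
    Sg o (fun i a => V i a ∧ V' i a) := by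
  obtain ⟨T, hT, hV, hm⟩ := h.mono
  obtain ⟨T', hT', hV', hm'⟩ := h'.mono
  refine ⟨fun q => T q ∧ T' q, hT.and hT', fun i a => ?_⟩
  beta_reduce
  rw [hV, hV']
  constructor
  · rintro ⟨⟨l, hl⟩, ⟨l', hl'⟩⟩
    exact ⟨max l l', hm _ _ _ _ (le_max_left _ _) hl, hm' _ _ _ _ (le_max_right _ _) hl'⟩
  · rintro ⟨l, h1, h2⟩
    exact ⟨⟨l, h1⟩, ⟨l, h2⟩⟩

theorem Sg.or {V V' : ι → α → Prop} (h : Sg o V) (h' : Sg o V') :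
    Sg o (fun i a => V i a ∨ V' i a) := by
  obtain ⟨T, hT, hV⟩ := h
  obtain ⟨T', hT', hV'⟩ := h'
  refine ⟨fun q => T q ∨ T' q, hT.or hT', fun i a => ?_⟩
  beta_reduce
  rw [hV, hV', exists_or]

theorem Sg.comp {V : ι → β → Prop} (h : Sg o V) {g : α → β} (hg : Primrec g) :
    Sg o (fun i a => V i (g a)) := by
  obtain ⟨T, hT, hV⟩ := h
  exact ⟨fun q => T (q.1, g q.2), hT.comp (Primrec.fst.pair (hg.comp Primrec.snd)),
    fun i a => by beta_reduce; rw [hV]⟩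

theorem Sg.ex {V : ι → α × β → Prop} (h : Sg o V) : Sg o (fun i a => ∃ b, V i (a, b)) := by
  obtain ⟨T, hT, hV, hm⟩ := h.mono
  refine ⟨fun q => ∃ k ∈ List.range q.1.length, ∃ b ∈ ((Encodable.decode k : Option β)).toList,
    T (q.1, (q.2, b)), ?_, ?_⟩
  · have h1 : PrimrecRel (fun (b : β) (q : List Bool × α) => T (q.1, (q.2, b))) := by
      refine hT.comp (f := fun p : β × (List Bool × α) => (p.2.1, (p.2.2, p.1))) ?_
      exact (Primrec.fst.comp Primrec.snd).pair
        ((Primrec.snd.comp Primrec.snd).pair Primrec.fst)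
    have h2 : PrimrecRel (fun (k : ℕ) (q : List Bool × α) =>
        ∃ b ∈ ((Encodable.decode k : Option β)).toList, T (q.1, (q.2, b))) :=
      h1.exists_mem_list.comp (Primrec.optionToList.comp (Primrec.decode.comp Primrec.fst))
        Primrec.snd
    exact h2.exists_mem_list.comp (Primrec.list_range.comp
      (Primrec.list_length.comp Primrec.fst)) Primrec.id
  · intro i a
    constructor
    · rintro ⟨b, hb⟩
      obtain ⟨l, hl⟩ := (hV _ _).1 hb
      refine ⟨max l (Encodable.encode b + 1), Encodable.encode b, ?_, b, ?_, ?_⟩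
      · simp [pre_length]
      · simp
      · exact hm _ _ _ _ (le_max_left _ _) hl
    · rintro ⟨l, k, hk, b, hb, h⟩
      exact ⟨b, (hV _ _).2 ⟨l, h⟩⟩

theorem Sg.ball {V : ι → α × β → Prop} (h : Sg o V) {g : α → List β} (hg : Primrec g) :
    Sg o (fun i a => ∀ b ∈ g a, V i (a, b)) := by
  obtain ⟨T, hT, hV, hm⟩ := h.mono
  refine ⟨fun q => ∀ b ∈ g q.2, T (q.1, (q.2, b)), ?_, ?_⟩
  · have h1 : PrimrecRel (fun (b : β) (q : List Bool × α) => T (q.1, (q.2, b))) := by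
      refine hT.comp (f := fun p : β × (List Bool × α) => (p.2.1, (p.2.2, p.1))) ?_
      exact (Primrec.fst.comp Primrec.snd).pair
        ((Primrec.snd.comp Primrec.snd).pair Primrec.fst)
    exact h1.forall_mem_list.comp (hg.comp Primrec.snd) Primrec.id
  · intro i a
    constructor
    · intro H
      have : ∀ L : List β, (∀ b ∈ L, V i (a, b)) → ∃ l, ∀ b ∈ L, T (pre (o i) l, (a, b)) := by
        intro L
        induction L with
        | nil => simp
        | cons c L ih =>
          intro hL
          obtain ⟨l, hl⟩ := ih (fun b hb => hL b (List.mem_cons_of_mem _ hb))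
          obtain ⟨l', hl'⟩ := (hV _ _).1 (hL c List.mem_cons_self)
          refine ⟨max l l', fun b hb => ?_⟩
          rcases List.mem_cons.1 hb with rfl | hb
          · exact hm _ _ _ _ (le_max_right _ _) hl'
          · exact hm _ _ _ _ (le_max_left _ _) (hl b hb)
      exact this _ H
    · rintro ⟨l, hl⟩ b hb
      exact (hV _ _).2 ⟨l, hl b hb⟩

theorem Sg.mem_self : Sg o (fun i (n : ℕ) => n ∈ o i) := by
  refine ⟨fun q => q.1[q.2]? = some true, ?_, fun i a => ?_⟩
  · exact Primrec.eq.comp (Primrec.list_getElem?.comp Primrec.fst Primrec.snd) (Primrec.const _)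
  · simp only [pre_getElem?]
    exact ⟨fun h => ⟨a + 1, by simp [h]⟩, fun ⟨l, h⟩ => by simpa using h.2⟩

theorem Sg.not_mem_self : Sg o (fun i (n : ℕ) => n ∉ o i) := by
  refine ⟨fun q => q.1[q.2]? = some false, ?_, fun i a => ?_⟩
  · exact Primrec.eq.comp (Primrec.list_getElem?.comp Primrec.fst Primrec.snd) (Primrec.const _)
  · simp only [pre_getElem?]
    exact ⟨fun h => ⟨a + 1, by simp [h]⟩, fun ⟨l, h⟩ => by simpa using h.2⟩

/-- The sets `X i` are uniformly decidable in the oracles `o i`. -/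
def Dc {ι α : Type*} [Primcodable α] (o : ι → Set ℕ) (V : ι → α → Prop) : Prop :=
  Sg o V ∧ Sg o (fun i a => ¬ V i a)

theorem Dc.self : Dc o (fun i n => n ∈ o i) := ⟨Sg.mem_self, Sg.not_mem_self⟩

theorem Dc.comp {V : ι → β → Prop} (h : Dc o V) {g : α → β} (hg : Primrec g) :
    Dc o (fun i a => V i (g a)) := ⟨h.1.comp hg, h.2.comp hg⟩

theorem Dc.prim {p : α → Prop} (h : PrimrecPred p) : Dc o (fun _ a => p a) :=
  ⟨Sg.prim h, Sg.prim h.not⟩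

theorem Dc.not {V : ι → α → Prop} (h : Dc o V) : Dc o (fun i a => ¬ V i a) :=
  ⟨h.2, h.1.of_eq fun _ _ => not_not.symm⟩

theorem Dc.and {V V' : ι → α → Prop} (h : Dc o V) (h' : Dc o V') :
    Dc o (fun i a => V i a ∧ V' i a) :=
  ⟨h.1.and h'.1, (h.2.or h'.2).of_eq fun _ _ => not_and_or.symm⟩

theorem Dc.or {V V' : ι → α → Prop} (h : Dc o V) (h' : Dc o V') :
    Dc o (fun i a => V i a ∨ V' i a) :=
  ⟨h.1.or h'.1, (h.2.and h'.2).of_eq fun _ _ => not_or.symm⟩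

theorem Dc.of_eq {V V' : ι → α → Prop} (h : Dc o V) (e : ∀ i a, V i a ↔ V' i a) : Dc o V' :=
  ⟨h.1.of_eq e, h.2.of_eq fun i a => not_congr (e i a)⟩

theorem Dc.ball {V : ι → α × β → Prop} (h : Dc o V) {g : α → List β} (hg : Primrec g) :
    Dc o (fun i a => ∀ b ∈ g a, V i (a, b)) := by
  refine ⟨h.1.ball hg, ?_⟩
  have : PrimrecPred (fun q : α × β => ∃ c ∈ g q.1, c = q.2) := by
    have h1 : PrimrecRel (fun (c : β) (q : α × β) => c = q.2) :=
      Primrec.eq.comp (Primrec.fst) (Primrec.snd.comp Primrec.snd)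
    exact h1.exists_mem_list.comp (hg.comp Primrec.fst) Primrec.id
  refine (((Sg.prim this).and h.2).ex).of_eq fun i a => ?_
  simp

/-- Substituting a uniformly decidable oracle. -/
theorem Sg.subst {T : List Bool × β → Prop} (hT : PrimrecPred T) {h : ι → α → Set ℕ}
    (hh : Dc o (fun i (p : α × ℕ) => p.2 ∈ h i p.1)) :
    Sg o (fun i (p : α × β) => ∃ l, T (pre (h i p.1) l, p.2)) := by
  have key : Sg o (fun i (q : (α × β) × List Bool) => T (q.2, q.1.2) ∧
      ∀ k ∈ List.range q.2.length, (q.2[k]? = some true ∧ k ∈ h i q.1.1) ∨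
        (q.2[k]? = some false ∧ ¬ k ∈ h i q.1.1)) := by
    refine Sg.and (Sg.prim (hT.comp (Primrec.snd.pair (Primrec.snd.comp Primrec.fst)))) ?_
    refine Sg.ball (V := fun i (r : ((α × β) × List Bool) × ℕ) =>
      (r.1.2[r.2]? = some true ∧ r.2 ∈ h i r.1.1.1) ∨
        (r.1.2[r.2]? = some false ∧ ¬ r.2 ∈ h i r.1.1.1)) ?_
        (Primrec.list_range.comp (Primrec.list_length.comp Primrec.snd))
    have hg : Primrec (fun r : ((α × β) × List Bool) × ℕ => (r.1.1.1, r.2)) :=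
      (Primrec.fst.comp (Primrec.fst.comp Primrec.fst)).pair Primrec.snd
    have he : ∀ b : Bool, PrimrecPred (fun r : ((α × β) × List Bool) × ℕ =>
        r.1.2[r.2]? = some b) := fun b =>
      Primrec.eq.comp (Primrec.list_getElem?.comp (Primrec.snd.comp Primrec.fst) Primrec.snd)
        (Primrec.const _)
    exact ((Sg.prim (he true)).and (hh.1.comp hg)).or ((Sg.prim (he false)).and (hh.2.comp hg))
  refine key.ex.of_eq fun i p => ?_
  constructor
  · rintro ⟨σ, h1, h2⟩
    refine ⟨σ.length, ?_⟩
    have : pre (h i p.1) σ.length = σ := by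
      apply List.ext_getElem?
      intro k
      by_cases hk : k < σ.length
      · rcases h2 k (List.mem_range.2 hk) with h3 | h3
        · simp only at h3
          rw [h3.1, pre_getElem?]; simp [hk, h3.2]
        · simp only at h3
          rw [h3.1, pre_getElem?]; simp [hk, h3.2]
      · rw [List.getElem?_eq_none (by simp [pre_length]; omega),
          List.getElem?_eq_none (by omega)]
    rw [this]; exact h1
  · rintro ⟨l, hl⟩
    refine ⟨pre (h i p.1) l, hl, fun k hk => ?_⟩
    simp only [pre_length, List.mem_range] at hk
    simp only [pre_getElem?, hk]
    by_cases h3 : k ∈ h i p.1 <;> simp [h3]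

theorem Sg.trans {o' : ι → Set ℕ} {V : ι → β → Prop} (hV : Sg o' V)
    (hh : Dc o (fun i n => n ∈ o' i)) : Sg o V := by
  obtain ⟨T, hT, hV⟩ := hV
  have := Sg.subst (α := Unit) hT (o := o) (h := fun i _ => o' i) (hh.comp Primrec.snd)
  refine (this.comp (g := fun b : β => ((), b)) ((Primrec.const _).pair Primrec.id)).of_eq ?_
  intro i a
  rw [hV]

theorem Dc.trans {o' : ι → Set ℕ} {V : ι → β → Prop} (hV : Dc o' V)
    (hh : Dc o (fun i n => n ∈ o' i)) : Dc o V := ⟨hV.1.trans hh, hV.2.trans hh⟩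

theorem mem_join_even {A B : Set ℕ} {n : ℕ} : 2 * n ∈ join A B ↔ n ∈ A := by
  simp only [join, Set.mem_ofPred_eq]
  constructor
  · rintro (⟨m, hm, h⟩ | ⟨m, hm, h⟩)
    · obtain rfl : n = m := by omega
      exact hm
    · omega
  · intro h; exact Or.inl ⟨n, h, rfl⟩

theorem mem_join_odd {A B : Set ℕ} {n : ℕ} : 2 * n + 1 ∈ join A B ↔ n ∈ B := by
  simp only [join, Set.mem_ofPred_eq]
  constructor
  · rintro (⟨m, hm, h⟩ | ⟨m, hm, h⟩)
    · omega
    · obtain rfl : n = m := by omega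
      exact hm
  · intro h; exact Or.inr ⟨n, h, rfl⟩

theorem mem_join {A B : Set ℕ} {n : ℕ} :
    n ∈ join A B ↔ (n % 2 = 0 ∧ n / 2 ∈ A) ∨ (¬ n % 2 = 0 ∧ n / 2 ∈ B) := by
  rcases Nat.even_or_odd' n with ⟨m, rfl | rfl⟩
  · rw [mem_join_even]; simp
  · rw [mem_join_odd]
    have h1 : (2 * m + 1) / 2 = m := by omega
    have h2 : ¬ (2 * m + 1) % 2 = 0 := by omega
    simp [h1, h2]

theorem Dc.left {A B : ι → Set ℕ} (h : Dc o (fun i n => n ∈ join (A i) (B i))) :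
    Dc o (fun i n => n ∈ A i) :=
  (h.comp Primrec.nat_double).of_eq fun _ _ => mem_join_even

theorem Dc.right {A B : ι → Set ℕ} (h : Dc o (fun i n => n ∈ join (A i) (B i))) :
    Dc o (fun i n => n ∈ B i) :=
  (h.comp Primrec.nat_double_succ).of_eq fun _ _ => mem_join_odd

/-- joins with parameters -/
theorem Dc.join {A B : ι → α → Set ℕ} (hA : Dc o (fun i (p : α × ℕ) => p.2 ∈ A i p.1))
    (hB : Dc o (fun i (p : α × ℕ) => p.2 ∈ B i p.1)) :
    Dc o (fun i (p : α × ℕ) => p.2 ∈ RRT.join (A i p.1) (B i p.1)) := by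
  have hg : Primrec (fun p : α × ℕ => (p.1, p.2 / 2)) :=
    Primrec.fst.pair (Primrec.nat_div.comp Primrec.snd (Primrec.const 2))
  have h0 : PrimrecPred (fun p : α × ℕ => p.2 % 2 = 0) :=
    Primrec.eq.comp (Primrec.nat_mod.comp Primrec.snd (Primrec.const 2)) (Primrec.const 0)
  exact (((Dc.prim h0).and (hA.comp hg)).or ((Dc.prim h0.not).and (hB.comp hg))).of_eq
    fun i p => mem_join.symm

theorem Dc.join' {A B : ι → Set ℕ} (hA : Dc o (fun i n => n ∈ A i))
    (hB : Dc o (fun i n => n ∈ B i)) :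
    Dc o (fun i n => n ∈ RRT.join (A i) (B i)) :=
  (Dc.join (α := Unit) (A := fun i _ => A i) (B := fun i _ => B i) (hA.comp Primrec.snd)
    (hB.comp Primrec.snd)).comp (g := fun n => ((), n)) ((Primrec.const _).pair Primrec.id)

end closure

/-- indices for Turing functionals -/
abbrev Fn := {T : List Bool × (ℕ × Bool) → Prop // PrimrecPred T}

instance : Countable Fn := by
  classical
  have : ∀ T : Fn, ∃ c : Nat.Partrec.Code, c.eval = fun n =>
     Part.bind ((Encodable.decode n : Option (List Bool × (ℕ × Bool))) : Part _) fun a =>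
      Part.some (Encodable.encode (decide (T.1 a))) := by
    intro T
    have h : Computable (fun a => decide (T.1 a)) := (PrimrecPred.decide T.2).to_comp
    obtain ⟨c, hc⟩ := Nat.Partrec.Code.exists_code.1 h
    exact ⟨c, by rw [hc]; funext n; congr⟩
  choose c hc using this
  refine Function.Injective.countable (f := c) fun T T' h => ?_
  apply Subtype.ext
  funext a
  have h1 := congrFun ((hc T).symm.trans ((congrArg _ h).trans (hc T'))) (Encodable.encode a)
  simp only [Encodable.encodek, Part.coe_some, Part.bind_some, Part.some_inj] at h1
  have h2 := Encodable.encode_injective h1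
  simpa using h2

def Ev (T : Fn) (O : Set ℕ) (w : ℕ) (v : Bool) : Prop := ∃ l, T.1 (pre O l, (w, v))

/-- `v` is the right value of the characteristic function at `w` -/
def Cor (W : Set ℕ) (w : ℕ) (v : Bool) : Prop := v = true ↔ w ∈ W

open Classical in
noncomputable def val (W : Set ℕ) (w : ℕ) : Bool := decide (w ∈ W)

theorem cor_iff {W : Set ℕ} {w : ℕ} {v : Bool} : v = val W w ↔ Cor W w v := by
  unfold val Cor
  cases v <;> simp

def Comp (T : Fn) (O W : Set ℕ) : Prop := ∀ w v, Ev T O w v ↔ v = val W w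

def Red (W O : Set ℕ) : Prop := ∃ T : Fn, Comp T O W

theorem red_of_sg {W O : Set ℕ} (h : Sg (fun _ : Unit => O) (fun _ (p : ℕ × Bool) => p.2 = val W p.1)) :
    Red W O := by
  obtain ⟨T, hT, hV⟩ := h
  exact ⟨⟨T, hT⟩, fun w v => ((hV () (w, v)).symm)⟩

theorem red_of_dc {W O : Set ℕ} (h : Dc (fun _ : Unit => O) (fun _ n => n ∈ W)) : Red W O := by
  apply red_of_sg
  have e : ∀ b : Bool, PrimrecPred (fun p : ℕ × Bool => p.2 = b) := fun b =>
    Primrec.eq.comp Primrec.snd (Primrec.const b)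
  refine (((Sg.prim (e true)).and (h.1.comp Primrec.fst)).or
    ((Sg.prim (e false)).and (h.2.comp Primrec.fst))).of_eq ?_
  rintro _ ⟨w, v⟩
  rw [cor_iff]; unfold Cor
  cases v <;> simp

theorem sg_ev {ι α : Type} [Primcodable α] {o : ι → Set ℕ} (T : Fn) {h : ι → α → Set ℕ}
    (hh : Dc o (fun i (p : α × ℕ) => p.2 ∈ h i p.1)) :
    Sg o (fun i (p : α × (ℕ × Bool)) => Ev T (h i p.1) p.2.1 p.2.2) :=
  Sg.subst T.2 hh

/-- Red is upward closed in the oracle -/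
theorem Red.trans {W O O' : Set ℕ} (h : Red W O)
    (hdc : Dc (fun _ : Unit => O') (fun _ n => n ∈ O)) : Red W O' := by
  obtain ⟨T, hT⟩ := h
  apply red_of_sg
  have : Sg (fun _ : Unit => O) (fun _ (p : ℕ × Bool) => p.2 = val W p.1) :=
    ⟨T.1, T.2, fun i a => (hT a.1 a.2).symm⟩
  exact this.trans hdc

/-- open subsets of Cantor space -/
def opn (P : Set ℕ → Prop) : Prop := ∀ x, P x → ∃ l : ℕ, ∀ y : Set ℕ, (∀ i < l, i ∈ x ↔ i ∈ y) → P y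

theorem cover {κ : Type*} (P : κ → Set ℕ → Prop) (ho : ∀ k, opn (P k)) (hc : ∀ x, ∃ k, P k x) :
    ∃ s : Finset κ, ∀ x, ∃ k ∈ s, P k x := by
  classical
  let st : (ℕ → Bool) → Set ℕ := fun x => {n | x n = true}
  have hopen : ∀ k, IsOpen {x : ℕ → Bool | P k (st x)} := by
    intro k
    rw [isOpen_iff_forall_mem_open]
    intro x hx
    obtain ⟨l, hl⟩ := ho k _ hx
    refine ⟨(fun (y : ℕ → Bool) (i : Fin l) => y i) ⁻¹' ({fun i : Fin l => x i} : Set (Fin l → Bool)), ?_, ?_, rfl⟩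
    · intro y hy
      apply hl
      intro i hi
      have : y i = x i := congrFun hy ⟨i, hi⟩
      change x i = true ↔ y i = true
      rw [this]
    · exact (isOpen_discrete _).preimage (by fun_prop)
  obtain ⟨s, hs⟩ := (isCompact_univ (X := ℕ → Bool)).elim_finite_subcover _ hopen (by
    intro x _
    obtain ⟨k, hk⟩ := hc (st x)
    exact Set.mem_iUnion.2 ⟨k, hk⟩)
  refine ⟨s, fun x => ?_⟩
  have := hs (Set.mem_univ (fun n => decide (n ∈ x)))
  simp only [Set.mem_iUnion] at this
  obtain ⟨k, hk, h⟩ := this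
  refine ⟨k, hk, ?_⟩
  have e : st (fun n => decide (n ∈ x)) = x := by ext n; simp [st]
  rw [← e]; exact h

theorem pre_join_congr {x y Y : Set ℕ} {l : ℕ} (h : ∀ i < l, i ∈ x ↔ i ∈ y) :
    pre (join x Y) l = pre (join y Y) l := by
  apply pre_congr
  intro i hi
  rw [mem_join, mem_join, h (i / 2) (by omega)]

theorem Sg.opn {α : Type} [Primcodable α] {Y : Set ℕ} {V : Set ℕ → α → Prop}
    (h : Sg (fun x => join x Y) V) (a : α) : opn (fun x => V x a) := by
  obtain ⟨T, hT, hV⟩ := h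
  intro x hx
  obtain ⟨l, hl⟩ := (hV _ _).1 hx
  refine ⟨l, fun y hy => (hV _ _).2 ⟨l, ?_⟩⟩
  beta_reduce
  rwa [← pre_join_congr hy]

/-- all boolean lists of length `n` -/
def allB : ℕ → List (List Bool)
  | 0 => [[]]
  | n + 1 => (allB n).map (List.cons true) ++ (allB n).map (List.cons false)

theorem mem_allB (l : List Bool) : l ∈ allB l.length := by
  induction l with
  | nil => simp [allB]
  | cons a l ih => cases a <;> simp [allB, ih]

theorem primrec_allB : Primrec allB := by
  have hs : Primrec₂ (fun (_ : ℕ) (p : ℕ × List (List Bool)) =>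
      p.2.map (List.cons true) ++ p.2.map (List.cons false)) := by
    have h1 : ∀ b : Bool, Primrec (fun q : ℕ × (ℕ × List (List Bool)) => q.2.2.map (List.cons b)) := by
      intro b
      exact Primrec.list_map (Primrec.snd.comp Primrec.snd)
        (Primrec.list_cons.comp (Primrec.const b) Primrec.snd)
    exact Primrec.list_append.comp (h1 true) (h1 false)
  refine (Primrec.nat_rec' (f := fun n : ℕ => n) (g := fun _ => [[]]) Primrec.id (Primrec.const _) hs).of_eq
    fun n => ?_
  induction n with
  | zero => rfl
  | succ n ih => simp only [allB]; rw [← ih]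

theorem compl_unif {α : Type} [Primcodable α] {Y : Set ℕ} {V : Set ℕ → α → Prop}
    (h : Sg (fun x => join x Y) V) : Sg (fun _ : Unit => Y) (fun _ a => ∀ x, V x a) := by
  obtain ⟨T, hT, hV, hm⟩ := h.mono
  have hDc : Dc (fun _ : Unit => Y) (fun _ (p : List Bool × ℕ) => p.2 ∈
      join {k | p.1[k]? = some true} Y) := by
    refine Dc.join (α := List Bool) (A := fun _ τ => {k | τ[k]? = some true}) (B := fun _ _ => Y)
      (Dc.prim (p := fun p : List Bool × ℕ => p.1[p.2]? = some true) ?_)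
      (Dc.self.comp Primrec.snd)
    exact Primrec.eq.comp (Primrec.list_getElem?.comp Primrec.fst Primrec.snd) (Primrec.const _)
  have h1 := Sg.subst (β := α × ℕ) (T := fun q => q.1.length = q.2.2 ∧ T (q.1, q.2.1))
    (by
      refine PrimrecPred.and ?_ (hT.comp (Primrec.fst.pair (Primrec.fst.comp Primrec.snd)))
      exact Primrec.eq.comp (Primrec.list_length.comp Primrec.fst) (Primrec.snd.comp Primrec.snd))
    (h := fun _ τ => join {k | τ[k]? = some true} Y) hDc
  have h2 := Sg.ball (α := α × ℕ) (β := List Bool) (g := fun p => allB p.2)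
    (h1.comp (g := fun r : (α × ℕ) × List Bool => (r.2, r.1)) (Primrec.snd.pair Primrec.fst))
    (primrec_allB.comp Primrec.snd)
  refine h2.ex.of_eq fun _ a => ?_
  constructor
  · rintro ⟨l, hl⟩ x
    obtain ⟨l', h3, h4⟩ := hl (pre x l) (by have := mem_allB (pre x l); rwa [pre_length] at this)
    simp only [pre_length] at h3 h4
    subst h3
    refine (hV _ _).2 ⟨l', ?_⟩
    beta_reduce
    rw [pre_join_congr (y := {k | (pre x l')[k]? = some true})]
    · exact h4
    · intro i hi
      simp [pre_getElem?, hi]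
  · intro H
    obtain ⟨s, hs⟩ := cover (fun l x => T (pre (join x Y) l, a))
      (fun l x hx => ⟨l, fun y hy => by beta_reduce at hx ⊢; rwa [← pre_join_congr hy]⟩)
      (fun x => (hV _ _).1 (H x))
    refine ⟨s.sup id, fun τ hτ => ⟨s.sup id, by simp [pre_length], ?_⟩⟩
    obtain ⟨k, hk, h⟩ := hs {k | τ[k]? = some true}
    exact hm _ _ _ _ (Finset.le_sup (f := id) hk) h

theorem lcore {W Y : Set ℕ} (hW : ¬ Red W Y) {V : Set ℕ → ℕ × Bool → Prop}
    (h : Sg (fun x => join x Y) V) :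
    (∃ w, ∀ x, V x (w, !val W w)) ∨ ∃ w x, ¬ V x (w, val W w) := by
  by_contra hc
  push Not at hc
  obtain ⟨h1, h2⟩ := hc
  apply hW
  apply red_of_sg
  refine (compl_unif h).of_eq ?_
  rintro _ ⟨w, v⟩
  constructor
  · intro H
    obtain ⟨x, hx⟩ := h1 w
    by_contra hne
    apply hx
    have : (!val W w) = v := by
      revert hne; cases v <;> cases val W w <;> simp
    rw [this]; exact H x
  · rintro h x
    simp only at h
    subst h
    exact h2 w x

theorem basis {W Y : Set ℕ} (hW : ¬ Red W Y) {P : Set ℕ → Prop}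
    (h : Sg (fun x => join x Y) (fun x (_ : Unit) => P x)) (hx : ∃ x, ¬ P x) :
    ∃ x, ¬ P x ∧ ¬ Red W (join x Y) := by
  let S := {P : Set ℕ → Prop // Sg (fun x => join x Y) (fun x (_ : Unit) => P x) ∧ ∃ x, ¬ P x}
  have step : ∀ (p : S) (T : Fn), ∃ q : S, (∀ x, p.1 x → q.1 x) ∧
      ∀ x, ¬ q.1 x → ¬ Comp T (join x Y) W := by
    rintro ⟨P, hP, hx⟩ T
    have hE : Sg (fun x => join x Y) (fun x (p : ℕ × Bool) => Ev T (join x Y) p.1 p.2) :=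
      ⟨T.1, T.2, fun _ _ => Iff.rfl⟩
    have hV : Sg (fun x => join x Y) (fun x (p : ℕ × Bool) => P x ∨ Ev T (join x Y) p.1 p.2) :=
      (hP.comp (g := fun _ => ()) (Primrec.const _)).or hE
    rcases lcore hW hV with ⟨w, hw⟩ | ⟨w, x, hwx⟩
    · refine ⟨⟨P, hP, hx⟩, fun _ h => h, fun x hx hC => ?_⟩
      have := (hC w _).1 ((hw x).resolve_left hx)
      revert this; cases val W w <;> simp
    · refine ⟨⟨fun x => P x ∨ Ev T (join x Y) w (val W w), ?_, x, hwx⟩, fun _ h => Or.inl h,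
        fun x hx hC => hx (Or.inr ((hC w _).2 rfl))⟩
      exact hV.comp (g := fun _ => (w, val W w)) (Primrec.const _)
  choose nx hn1 hn2 using step
  have hF : Nonempty Fn := ⟨⟨fun p => p.2.1 = 0,
    Primrec.eq.comp (Primrec.fst.comp Primrec.snd) (Primrec.const 0)⟩⟩
  obtain ⟨e, he⟩ := exists_surjective_nat Fn
  let seq : ℕ → S := fun n => n.rec ⟨P, h, hx⟩ (fun k p => nx p (e k))
  have hmono : ∀ m k x, (seq m).1 x → (seq (m + k)).1 x := by
    intro m k
    induction k with
    | zero => exact fun _ h => h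
    | succ k ih => exact fun x hx => hn1 _ _ _ (ih x hx)
  have : ∃ x, ∀ k, ¬ (seq k).1 x := by
    by_contra hc
    push Not at hc
    obtain ⟨s, hs⟩ := cover (fun k x => (seq k).1 x) (fun k => (seq k).2.1.opn ()) hc
    obtain ⟨x, hx⟩ := (seq (s.sup id)).2.2
    obtain ⟨k, hk, h⟩ := hs x
    apply hx
    obtain ⟨d, hd⟩ := Nat.exists_eq_add_of_le (Finset.le_sup (f := id) hk)
    rw [hd]; exact hmono _ _ _ h
  obtain ⟨x, hx⟩ := this
  refine ⟨x, hx 0, ?_⟩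
  rintro ⟨T, hT⟩
  obtain ⟨k, rfl⟩ := he T
  exact hn2 _ _ x (hx (k + 1)) hT

theorem lmain {W Y : Set ℕ} (hW : ¬ Red W Y) {V : Set ℕ → ℕ × Bool → Prop}
    (h : Sg (fun x => join x Y) V) :
    (∃ w, ∀ x, V x (w, !val W w)) ∨ ∃ w x, ¬ V x (w, val W w) ∧ ¬ Red W (join x Y) := by
  rcases lcore hW h with h1 | ⟨w, x, hx⟩
  · exact Or.inl h1
  · right
    obtain ⟨x, h1, h2⟩ := basis hW (P := fun x => V x (w, val W w))
      (h.comp (g := fun _ => (w, val W w)) (Primrec.const _)) ⟨x, hx⟩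
    exact ⟨w, x, h1, h2⟩

theorem mathias {κ : Type} [Countable κ] [Nonempty κ] (cond : List ℕ → Set ℕ → Prop)
    (Req : κ → Set ℕ → Prop)
    (step : ∀ i F R, cond F R → ∃ (E : List ℕ) (R' : Set ℕ), (∀ a ∈ E, a ∈ R) ∧ R' ⊆ R ∧
      cond (E ++ F) R' ∧
      ∀ G : Set ℕ, (∀ a ∈ E ++ F, a ∈ G) → (∀ a ∈ G, a ∈ E ++ F ∨ a ∈ R') → Req i G)
    (F : List ℕ) (R : Set ℕ) (h : cond F R) :
    ∃ G : Set ℕ, (∀ a ∈ F, a ∈ G) ∧ (∀ a ∈ G, a ∈ F ∨ a ∈ R) ∧ (∀ i, Req i G) ∧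
      ∀ L : List ℕ, (∀ a ∈ L, a ∈ G) → ∃ F' R', cond F' R' ∧ (∀ a ∈ L, a ∈ F') ∧
        (∀ a ∈ F', a ∈ G) ∧ (∀ a ∈ G, a ∈ F' ∨ a ∈ R') := by
  obtain ⟨e, he⟩ := exists_surjective_nat κ
  let S := {p : List ℕ × Set ℕ // cond p.1 p.2}
  have step' : ∀ (i : κ) (p : S), ∃ q : S, (∀ a ∈ p.1.1, a ∈ q.1.1) ∧
      (∀ a ∈ q.1.1, a ∈ p.1.1 ∨ a ∈ p.1.2) ∧ q.1.2 ⊆ p.1.2 ∧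
      ∀ G : Set ℕ, (∀ a ∈ q.1.1, a ∈ G) → (∀ a ∈ G, a ∈ q.1.1 ∨ a ∈ q.1.2) → Req i G := by
    rintro i ⟨⟨F, R⟩, h⟩
    obtain ⟨E, R', h1, h2, h3, h4⟩ := step i F R h
    refine ⟨⟨(E ++ F, R'), h3⟩, ?_, ?_, h2, h4⟩
    · intro a ha; exact List.mem_append_right _ ha
    · intro a ha
      rcases List.mem_append.1 ha with ha | ha
      · exact Or.inr (h1 a ha)
      · exact Or.inl ha
  choose nx h1 h2 h3 h4 using step'
  let s : ℕ → S := fun n => n.rec ⟨(F, R), h⟩ (fun k p => nx (e k) p)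
  have m1 : ∀ m k, ∀ a ∈ (s m).1.1, a ∈ (s (m + k)).1.1 := by
    intro m k
    induction k with
    | zero => exact fun _ h => h
    | succ k ih => exact fun a ha => h1 _ _ _ (ih a ha)
  have m2 : ∀ m k, (∀ a ∈ (s (m + k)).1.1, a ∈ (s m).1.1 ∨ a ∈ (s m).1.2) ∧
      (s (m + k)).1.2 ⊆ (s m).1.2 := by
    intro m k
    induction k with
    | zero => exact ⟨fun _ h => Or.inl h, fun _ h => h⟩
    | succ k ih =>
      refine ⟨fun a ha => ?_, fun a ha => ih.2 (h3 _ _ ha)⟩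
      rcases h2 _ _ _ ha with h | h
      · exact ih.1 a h
      · exact Or.inr (ih.2 h)
  have m1' : ∀ m k, m ≤ k → ∀ a ∈ (s m).1.1, a ∈ (s k).1.1 := by
    intro m k hk
    obtain ⟨d, rfl⟩ := Nat.exists_eq_add_of_le hk
    exact m1 m d
  have m2' : ∀ m k, ∀ a ∈ (s k).1.1, a ∈ (s m).1.1 ∨ a ∈ (s m).1.2 := by
    intro m k a ha
    rcases le_total m k with hk | hk
    · obtain ⟨d, rfl⟩ := Nat.exists_eq_add_of_le hk
      exact (m2 m d).1 a ha
    · exact Or.inl (m1' _ _ hk a ha)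
  refine ⟨{a | ∃ k, a ∈ (s k).1.1}, fun a ha => ⟨0, ha⟩, ?_, ?_, ?_⟩
  · rintro a ⟨k, hk⟩; exact m2' 0 k a hk
  · intro i
    obtain ⟨k, rfl⟩ := he i
    apply h4 (e k) (s k)
    · intro a ha; exact ⟨k + 1, ha⟩
    · rintro a ⟨j, hj⟩; exact m2' (k + 1) j a hj
  · intro L hL
    have : ∃ k, ∀ a ∈ L, a ∈ (s k).1.1 := by
      induction L with
      | nil => exact ⟨0, by simp⟩
      | cons b L ih =>
        obtain ⟨k, hk⟩ := ih (fun a ha => hL a (List.mem_cons_of_mem _ ha))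
        obtain ⟨j, hj⟩ := hL b List.mem_cons_self
        refine ⟨max k j, fun a ha => ?_⟩
        rcases List.mem_cons.1 ha with rfl | ha
        · exact m1' _ _ (le_max_right _ _) _ hj
        · exact m1' _ _ (le_max_left _ _) _ (hk a ha)
    obtain ⟨k, hk⟩ := this
    exact ⟨(s k).1.1, (s k).1.2, (s k).2, hk, fun a ha => ⟨k, ha⟩,
      fun a ⟨j, hj⟩ => m2' k j a hj⟩

/-- the finite set given by a list -/
def fs (L : List ℕ) : Set ℕ := {a | a ∈ L}

theorem mem_fs {L : List ℕ} {a : ℕ} : a ∈ fs L ↔ a ∈ L := Iff.rfl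

/-- strictly decreasing lists -/
def dec (L : List ℕ) : Prop := L.Pairwise (fun a b => b < a)

theorem primrec_mem {β : Type} [Primcodable β] : PrimrecRel (fun (a : β) (L : List β) => a ∈ L) := by
  have h1 : PrimrecRel (fun (c : β) (q : β × List β) => c = q.1) :=
    Primrec.eq.comp Primrec.fst (Primrec.fst.comp Primrec.snd)
  have h2 : PrimrecPred (fun q : β × List β => ∃ c ∈ q.2, c = q.1) :=
    h1.exists_mem_list.comp Primrec.snd Primrec.id
  exact h2.of_eq (fun q => by simp)

theorem Dc.fs {ι : Type} {o : ι → Set ℕ} {α : Type} [Primcodable α] {g : α → List ℕ} (hg : Primrec g) :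
    Dc o (fun _ (p : α × ℕ) => p.2 ∈ RRT.fs (g p.1)) :=
  Dc.prim (primrec_mem.comp Primrec.snd (hg.comp Primrec.fst))

/-- Reservoir membership is decidable. -/
theorem dc_subset {ι : Type} {o : ι → Set ℕ} {R : ι → Set ℕ} (h : Dc o (fun i n => n ∈ R i)) :
    Dc o (fun i (E : List ℕ) => ∀ a ∈ E, a ∈ R i) :=
  Dc.ball (V := fun i (p : List ℕ × ℕ) => p.2 ∈ R i) (h.comp Primrec.snd) Primrec.id

theorem exists_list (G : Set ℕ) (l : ℕ) : ∃ L : List ℕ, dec L ∧ ∀ a, a ∈ L ↔ a < l ∧ a ∈ G := by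
  classical
  refine ⟨((List.range l).reverse).filter (fun a => decide (a ∈ G)), ?_, ?_⟩
  · apply List.Pairwise.filter
    rw [List.pairwise_reverse]
    exact List.pairwise_lt_range
  · intro a; simp

theorem red_fin {W R R' Z : Set ℕ} {l : ℕ} (h : ∀ i, l ≤ i → (i ∈ R ↔ i ∈ R'))
    (hr : Red W (join R Z)) : Red W (join R' Z) := by
  apply hr.trans
  obtain ⟨L, -, hL⟩ := exists_list R l
  have h0 : Dc (fun _ : Unit => join R' Z) (fun _ n => n ∈ join R' Z) := Dc.self
  have h1 : Dc (fun _ : Unit => join R' Z) (fun _ n => n ∈ R') := Dc.left h0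
  have h2 : Dc (fun _ : Unit => join R' Z) (fun _ n => n ∈ Z) := Dc.right h0
  have h3 : Dc (fun _ : Unit => join R' Z) (fun _ n => n ∈ R) := by
    have p1 : PrimrecPred (fun n : ℕ => n ∈ L) := primrec_mem.comp Primrec.id (Primrec.const _)
    have p2 : PrimrecPred (fun n : ℕ => l ≤ n) := Primrec.nat_le.comp (Primrec.const _) Primrec.id
    refine ((Dc.prim p1).or ((Dc.prim p2).and h1)).of_eq fun _ n => ?_
    beta_reduce
    rw [hL]
    by_cases hn : l ≤ n
    · simp [hn, h n hn]
    · simp [hn]; intro _; omega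
  exact Dc.join' (A := fun _ => R) (B := fun _ => Z) h3 h2

theorem not_red_ge {W R Z : Set ℕ} (l : ℕ) (h : ¬ Red W (join R Z)) :
    ¬ Red W (join {a | a ∈ R ∧ l ≤ a} Z) := fun hr =>
  h (red_fin (l := l) (fun i hi => by simp [hi]) hr)

theorem inf_ge {R : Set ℕ} (l : ℕ) (h : R.Infinite) : {a | a ∈ R ∧ l ≤ a}.Infinite := by
  intro hf
  apply h
  refine (hf.union (Set.finite_lt_nat l)).subset ?_
  intro a ha
  by_cases hl : l ≤ a
  · exact Or.inl ⟨ha, hl⟩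
  · exact Or.inr (not_le.1 hl)

theorem ev_use {T : Fn} {A Z : Set ℕ} {w : ℕ} {v : Bool} (h : Ev T (join A Z) w v) :
    ∃ l, ∀ G : Set ℕ, (∀ i < l, i ∈ A ↔ i ∈ G) → Ev T (join G Z) w v := by
  have hE : Sg (fun x => join x Z) (fun x (p : ℕ × Bool) => Ev T (join x Z) p.1 p.2) :=
      ⟨T.1, T.2, fun _ _ => Iff.rfl⟩
  exact hE.opn (w, v) A h

theorem wrong {T : Fn} {W Z : Set ℕ} {L : List ℕ} {w : ℕ}
    (h : Ev T (join (fs L) Z) w (!val W w)) :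
    ∃ l, ∀ G : Set ℕ, (∀ a ∈ L, a ∈ G) → (∀ a ∈ G, a ∈ L ∨ l ≤ a) → ¬ Comp T (join G Z) W := by
  obtain ⟨l, hl⟩ := ev_use h
  refine ⟨l, fun G h1 h2 hC => ?_⟩
  have := (hC w _).1 (hl G (fun i hi => ⟨h1 i, fun hG => (h2 i hG).resolve_right (by omega)⟩))
  revert this; cases val W w <;> simp

theorem never {T : Fn} {W Z : Set ℕ} {F : List ℕ} {w : ℕ} {G : Set ℕ} (hF : ∀ a ∈ F, a ∈ G)
    (h : ∀ E, dec E → (∀ a ∈ E, a ∈ G ∧ a ∉ F) → ¬ Ev T (join (fs (E ++ F)) Z) w (val W w)) :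
    ¬ Comp T (join G Z) W := by
  intro hC
  obtain ⟨l, hl⟩ := ev_use ((hC w _).2 rfl)
  obtain ⟨L, hd, hL⟩ := exists_list {a | a ∈ G ∧ a ∉ F} l
  refine h L hd (fun a ha => ((hL a).1 ha).2) (hl _ ?_)
  intro i hi
  rw [mem_fs, List.mem_append, hL]
  by_cases hiF : i ∈ F
  · simp [hiF, hF i hiF]
  · simp [hiF, hi]

theorem gamma {W O Z : Set ℕ} (hW : ¬ Red W O) (hZ : Dc (fun _ : Unit => O) (fun _ n => n ∈ Z))
    (T : Fn) (F : List ℕ) {D : List ℕ → Prop} (hD : Sg (fun _ : Unit => O) (fun _ E => D E)) :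
    (∃ w E, D E ∧ Ev T (join (fs (E ++ F)) Z) w (!val W w)) ∨
      ∃ w, ∀ E, D E → ¬ Ev T (join (fs (E ++ F)) Z) w (val W w) := by
  by_contra hc
  push Not at hc
  obtain ⟨h1, h2⟩ := hc
  apply hW
  apply red_of_sg
  have hJ : Dc (fun _ : Unit => O) (fun _ (p : List ℕ × ℕ) => p.2 ∈ join (fs (p.1 ++ F)) Z) :=
    Dc.join (A := fun _ E => fs (E ++ F)) (B := fun _ _ => Z)
      (Dc.fs (Primrec.list_append.comp Primrec.id (Primrec.const _))) (hZ.comp Primrec.snd)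
  have hE := sg_ev T (h := fun _ (E : List ℕ) => join (fs (E ++ F)) Z) hJ
  have h3 := (hD.comp (g := fun p : (ℕ × Bool) × List ℕ => p.2) Primrec.snd).and
    (hE.comp (g := fun p : (ℕ × Bool) × List ℕ => (p.2, p.1)) (Primrec.snd.pair Primrec.fst))
  refine h3.ex.of_eq ?_
  rintro _ ⟨w, v⟩
  constructor
  · rintro ⟨E, hE, hv⟩
    by_contra hne
    apply h1 w E hE
    have : (!val W w) = v := by
      revert hne; cases v <;> cases val W w <;> simp
    rw [this]; exact hv
  · intro h
    simp only at h
    subst h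
    exact h2 w

theorem inf_ge_mem {R : Set ℕ} (h : R.Infinite) (n : ℕ) : ∃ a ∈ R, n ≤ a := by
  obtain ⟨a, ha, hn⟩ := h.exists_gt n
  exact ⟨a, ha, hn.le⟩

theorem inf_of_ge {G : Set ℕ} (h : ∀ n, ∃ a ∈ G, n ≤ a) : G.Infinite := by
  intro hf
  obtain ⟨m, hm⟩ := hf.bddAbove
  obtain ⟨a, ha, hn⟩ := h (m + 1)
  have := hm ha
  omega

theorem max_list (F : List ℕ) : ∃ m, ∀ a ∈ F, a < m := by
  induction F with
  | nil => exact ⟨0, by simp⟩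
  | cons b F ih =>
    obtain ⟨m, hm⟩ := ih
    refine ⟨max m (b + 1), fun a ha => ?_⟩
    rcases List.mem_cons.1 ha with rfl | ha
    · omega
    · have := hm a ha; omega

/-- good reservoirs -/
def gr (W Z R : Set ℕ) : Prop := R.Infinite ∧ ¬ Red W (join R Z)

theorem gr.ge {W Z R : Set ℕ} (h : gr W Z R) (l : ℕ) : gr W Z {a | a ∈ R ∧ l ≤ a} :=
  ⟨inf_ge l h.1, not_red_ge l h.2⟩

/-- sets decidable from a join -/
theorem red_mono {W Z O R' : Set ℕ} (h : Dc (fun _ : Unit => O) (fun _ n => n ∈ R'))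
    (hZ : Dc (fun _ : Unit => O) (fun _ n => n ∈ Z)) (hO : ¬ Red W O) : ¬ Red W (join R' Z) :=
  fun hr => hO (hr.trans (Dc.join' (A := fun _ => R') (B := fun _ => Z) h hZ))

theorem ph {W Z R : Set ℕ} (hR : gr W Z R) (A : Set ℕ) :
    ∃ R' ⊆ R, gr W Z R' ∧ (R' ⊆ A ∨ ∀ a ∈ R', a ∉ A) := by
  classical
  by_contra hno
  push Not at hno
  -- every reservoir meets both sides infinitely often
  have key : ∀ R' ⊆ R, gr W Z R' → ∀ n, (∃ a ∈ R', n ≤ a ∧ a ∈ A) ∧ (∃ a ∈ R', n ≤ a ∧ a ∉ A) := by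
    intro R' h1 h2 n
    have h3 := hno _ (fun a ha => h1 ha.1) (h2.ge n)
    constructor
    · obtain ⟨a, ha, haA⟩ := h3.2
      exact ⟨a, ha.1, ha.2, haA⟩
    · obtain ⟨a, ha, haA⟩ := Set.not_subset.1 h3.1
      exact ⟨a, ha.1, ha.2, haA⟩
  obtain ⟨G, -, hGR, hreq, -⟩ := mathias (κ := ℕ ⊕ (Fn × Fn)) (fun _ R' => R' ⊆ R ∧ gr W Z R')
    (fun i G => match i with
      | Sum.inl n => (∃ a ∈ G, n ≤ a ∧ a ∈ A) ∧ (∃ a ∈ G, n ≤ a ∧ a ∉ A)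
      | Sum.inr (T0, T1) => ¬ Comp T0 (join {a | a ∈ G ∧ a ∈ A} Z) W ∨
          ¬ Comp T1 (join {a | a ∈ G ∧ a ∉ A} Z) W)
    (by
      rintro (n | ⟨T0, T1⟩) F R1 ⟨hR1, hg⟩
      · obtain ⟨⟨a, ha, h1, h2⟩, ⟨b, hb, h3, h4⟩⟩ := key R1 hR1 hg n
        refine ⟨[a, b], R1, by simp [ha, hb], fun _ h => h, ⟨hR1, hg⟩, fun G h5 _ =>
          ⟨⟨a, h5 a (by simp), h1, h2⟩, ⟨b, h5 b (by simp), h3, h4⟩⟩⟩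
      · set F0 := F.filter (fun a => decide (a ∈ A)) with hF0
        set F1 := F.filter (fun a => decide (a ∉ A)) with hF1
        have m0 : ∀ a, a ∈ F0 ↔ a ∈ F ∧ a ∈ A := by simp [hF0]
        have m1 : ∀ a, a ∈ F1 ↔ a ∈ F ∧ a ∉ A := by simp [hF1]
        let o : Set ℕ → Set ℕ := fun x => join x (join R1 Z)
        have dx : Dc o (fun x n => n ∈ x) := Dc.left (A := fun x => x) (B := fun _ => join R1 Z) Dc.self
        have dRZ : Dc o (fun _ n => n ∈ join R1 Z) :=
          Dc.right (A := fun x => x) (B := fun _ => join R1 Z) Dc.self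
        have dR := Dc.left (A := fun _ => R1) (B := fun _ => Z) dRZ
        have dZ := Dc.right (A := fun _ => R1) (B := fun _ => Z) dRZ
        have hev : ∀ (T : Fn) (F : List ℕ), Sg o (fun _ (p : (ℕ × Bool) × List ℕ) =>
            Ev T (join (fs (p.2 ++ F)) Z) p.1.1 p.1.2) := by
          intro T F
          have hJ : Dc o (fun _ (p : List ℕ × ℕ) => p.2 ∈ join (fs (p.1 ++ F)) Z) :=
            Dc.join (A := fun _ E => fs (E ++ F)) (B := fun _ _ => Z)
              (Dc.fs (Primrec.list_append.comp Primrec.id (Primrec.const _))) (dZ.comp Primrec.snd)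
          exact (sg_ev T (h := fun _ (E : List ℕ) => join (fs (E ++ F)) Z) hJ).comp
            (g := fun p : (ℕ × Bool) × List ℕ => (p.2, p.1)) (Primrec.snd.pair Primrec.fst)
        have hsub : ∀ {X : Set ℕ → Set ℕ}, Dc o (fun x n => n ∈ X x) →
            Sg o (fun x (p : (ℕ × Bool) × List ℕ) => ∀ a ∈ p.2, a ∈ X x) := fun h =>
          ((dc_subset h).comp (g := fun p : (ℕ × Bool) × List ℕ => p.2) Primrec.snd).1
        have hV := ((hsub dR).and (((hsub dx).and (hev T0 F0)).or
          ((hsub (X := fun x => xᶜ) dx.not).and (hev T1 F1)))).ex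
        rcases lmain hg.2 hV with ⟨w, hw⟩ | ⟨w, x, hw, hx⟩
        · obtain ⟨E, h1, ⟨h2, h3⟩ | ⟨h2, h3⟩⟩ := hw A
          · obtain ⟨l, hl⟩ := wrong h3
            refine ⟨E, _, h1, fun a ha => ha.1, ⟨fun a ha => hR1 ha.1, hg.ge l⟩, fun G h4 h5 => ?_⟩
            left
            apply hl
            · intro a ha
              rcases List.mem_append.1 ha with ha | ha
              · exact ⟨h4 a (by simp [ha]), h2 a ha⟩
              · exact ⟨h4 a (by simp [((m0 a).1 ha).1]), ((m0 a).1 ha).2⟩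
            · rintro a ⟨ha, haA⟩
              rcases h5 a ha with h | h
              · left
                rcases List.mem_append.1 h with h | h
                · simp [h]
                · simp [m0, h, haA]
              · exact Or.inr h.2
          · obtain ⟨l, hl⟩ := wrong h3
            refine ⟨E, _, h1, fun a ha => ha.1, ⟨fun a ha => hR1 ha.1, hg.ge l⟩, fun G h4 h5 => ?_⟩
            right
            apply hl
            · intro a ha
              rcases List.mem_append.1 ha with ha | ha
              · exact ⟨h4 a (by simp [ha]), h2 a ha⟩
              · exact ⟨h4 a (by simp [((m1 a).1 ha).1]), ((m1 a).1 ha).2⟩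
            · rintro a ⟨ha, haA⟩
              rcases h5 a ha with h | h
              · left
                rcases List.mem_append.1 h with h | h
                · simp [h]
                · simp [m1, h, haA]
              · exact Or.inr h.2
        · have o1 : Dc (fun _ : Unit => join x (join R1 Z)) (fun _ n => n ∈ x) :=
            Dc.left (A := fun _ => x) (B := fun _ => join R1 Z) Dc.self
          have o2 : Dc (fun _ : Unit => join x (join R1 Z)) (fun _ n => n ∈ join R1 Z) :=
            Dc.right (A := fun _ => x) (B := fun _ => join R1 Z) Dc.self
          have oR := Dc.left (A := fun _ => R1) (B := fun _ => Z) o2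
          have oZ := Dc.right (A := fun _ => R1) (B := fun _ => Z) o2
          push Not at hw
          by_cases hinf : {a | a ∈ R1 ∧ a ∈ x}.Infinite
          · refine ⟨[], {a | a ∈ R1 ∧ a ∈ x}, by simp, fun a ha => ha.1,
              ⟨fun a ha => hR1 ha.1, hinf, red_mono (oR.and o1) oZ hx⟩, fun G h4 h5 => ?_⟩
            left
            apply never (F := F0)
            · intro a ha; exact ⟨h4 a (by simp [((m0 a).1 ha).1]), ((m0 a).1 ha).2⟩
            · intro E _ hE
              have : ∀ a ∈ E, a ∈ R1 ∧ a ∈ x := by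
                intro a ha
                obtain ⟨⟨q1, q2⟩, q3⟩ := hE a ha
                refine (h5 a q1).resolve_left (fun q => q3 ((m0 a).2 ⟨by simpa using q, q2⟩))
              exact (hw E (fun a ha => (this a ha).1)).1 (fun a ha => (this a ha).2)
          · have hinf' : {a | a ∈ R1 ∧ a ∉ x}.Infinite := by
              intro hf
              apply hg.1
              refine ((Set.not_infinite.1 hinf).union hf).subset fun a ha => ?_
              by_cases h : a ∈ x
              · exact Or.inl ⟨ha, h⟩
              · exact Or.inr ⟨ha, h⟩
            refine ⟨[], {a | a ∈ R1 ∧ a ∉ x}, by simp, fun a ha => ha.1,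
              ⟨fun a ha => hR1 ha.1, hinf', red_mono (oR.and o1.not) oZ hx⟩, fun G h4 h5 => ?_⟩
            right
            apply never (F := F1)
            · intro a ha; exact ⟨h4 a (by simp [((m1 a).1 ha).1]), ((m1 a).1 ha).2⟩
            · intro E _ hE
              have : ∀ a ∈ E, a ∈ R1 ∧ a ∉ x := by
                intro a ha
                obtain ⟨⟨q1, q2⟩, q3⟩ := hE a ha
                refine (h5 a q1).resolve_left (fun q => q3 ((m1 a).2 ⟨by simpa using q, q2⟩))
              exact (hw E (fun a ha => (this a ha).1)).2 (fun a ha => (this a ha).2)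
      ) [] R ⟨fun _ h => h, hR⟩
  have hGR' : G ⊆ R := fun a ha => (hGR a ha).resolve_left (by simp)
  have i1 : {a | a ∈ G ∧ a ∈ A}.Infinite := inf_of_ge fun n => by
    obtain ⟨a, h1, h2, h3⟩ := (hreq (Sum.inl n)).1; exact ⟨a, ⟨h1, h3⟩, h2⟩
  have i2 : {a | a ∈ G ∧ a ∉ A}.Infinite := inf_of_ge fun n => by
    obtain ⟨a, h1, h2, h3⟩ := (hreq (Sum.inl n)).2; exact ⟨a, ⟨h1, h3⟩, h2⟩
  by_cases hr : Red W (join {a | a ∈ G ∧ a ∈ A} Z)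
  · by_cases hr' : Red W (join {a | a ∈ G ∧ a ∉ A} Z)
    · obtain ⟨T0, h0⟩ := hr
      obtain ⟨T1, h1⟩ := hr'
      rcases hreq (Sum.inr (T0, T1)) with h | h
      · exact h h0
      · exact h h1
    · obtain ⟨a, ha, haA⟩ := (hno _ (fun a ha => hGR' ha.1) ⟨i2, hr'⟩).2
      exact ha.2 haA
  · exact (hno _ (fun a ha => hGR' ha.1) ⟨i1, hr⟩).1 (fun a ha => ha.2)

theorem ph_fin {W Z : Set ℕ} {κ : Type*} (P : κ → ℕ → Prop) (s : Finset κ) :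
    ∀ {R : Set ℕ}, gr W Z R → (∀ a ∈ R, ∃ k ∈ s, P k a) →
    ∃ k ∈ s, ∃ R' ⊆ R, gr W Z R' ∧ ∀ a ∈ R', P k a := by
  classical
  induction s using Finset.induction_on with
  | empty =>
    intro R hR h
    obtain ⟨a, ha⟩ := hR.1.nonempty
    obtain ⟨k, hk, -⟩ := h a ha
    simp at hk
  | insert k s hks ih =>
    intro R hR h
    obtain ⟨R', h1, h2, h3 | h3⟩ := ph hR {a | P k a}
    · exact ⟨k, by simp, R', h1, h2, h3⟩
    · obtain ⟨k', hk', R'', h4, h5, h6⟩ := ih h2 (fun a ha => by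
        obtain ⟨j, hj, hja⟩ := h a (h1 ha)
        rcases Finset.mem_insert.1 hj with rfl | hj
        · exact absurd hja (h3 a ha)
        · exact ⟨j, hj, hja⟩)
      exact ⟨k', by simp [hk'], R'', h4.trans h1, h5, h6⟩

theorem coh {W Z R : Set ℕ} (hR : gr W Z R) {κ : Type} [Countable κ] (A : κ → Set ℕ) :
    ∃ C ⊆ R, gr W Z C ∧ ∀ k, ∃ m, (∀ a ∈ C, m ≤ a → a ∈ A k) ∨ (∀ a ∈ C, m ≤ a → a ∉ A k) := by
  obtain ⟨G, -, hGR, hreq, -⟩ := mathias (κ := κ ⊕ (ℕ ⊕ Fn)) (fun _ R' => gr W Z R')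
    (fun i G => match i with
      | Sum.inl k => ∃ m, (∀ a ∈ G, m ≤ a → a ∈ A k) ∨ (∀ a ∈ G, m ≤ a → a ∉ A k)
      | Sum.inr (Sum.inl n) => ∃ a ∈ G, n ≤ a
      | Sum.inr (Sum.inr T) => ¬ Comp T (join G Z) W)
    (by
      rintro (k | n | T) F R1 hg
      · obtain ⟨R', h1, h2, h3⟩ := ph hg (A k)
        obtain ⟨m, hm⟩ := max_list F
        refine ⟨[], R', by simp, h1, h2, fun G _ h5 => ⟨m, ?_⟩⟩
        have : ∀ a ∈ G, m ≤ a → a ∈ R' := fun a ha hma => (h5 a ha).resolve_left fun h => by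
          have := hm a (by simpa using h); omega
        rcases h3 with h3 | h3
        · exact Or.inl fun a ha hma => h3 (this a ha hma)
        · exact Or.inr fun a ha hma => h3 a (this a ha hma)
      · obtain ⟨a, ha, hn⟩ := inf_ge_mem hg.1 n
        exact ⟨[a], R1, by simp [ha], fun _ h => h, hg, fun G h _ => ⟨a, h a (by simp), hn⟩⟩
      · have oR : Dc (fun _ : Unit => join R1 Z) (fun _ n => n ∈ R1) :=
          Dc.left (A := fun _ => R1) (B := fun _ => Z) Dc.self
        have oZ : Dc (fun _ : Unit => join R1 Z) (fun _ n => n ∈ Z) :=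
          Dc.right (A := fun _ => R1) (B := fun _ => Z) Dc.self
        rcases gamma hg.2 oZ T F (dc_subset oR).1 with ⟨w, E, h1, h2⟩ | ⟨w, h⟩
        · obtain ⟨l, hl⟩ := wrong h2
          exact ⟨E, _, h1, fun a ha => ha.1, hg.ge l, fun G h4 h5 => hl G h4 fun a ha =>
            (h5 a ha).imp id fun h => h.2⟩
        · refine ⟨[], R1, by simp, fun _ h => h, hg, fun G h4 h5 => never (F := F) (w := w) h4 ?_⟩
          intro E _ hE
          exact h E fun a ha => (h5 a (hE a ha).1).resolve_left (hE a ha).2) [] R hR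
  refine ⟨G, fun a ha => (hGR a ha).resolve_left (by simp), ⟨inf_of_ge fun n => hreq (Sum.inr (Sum.inl n)), ?_⟩,
    fun k => hreq (Sum.inl k)⟩
  rintro ⟨T, hT⟩
  exact hreq (Sum.inr (Sum.inr T)) hT

/-- binary relation on lists coded by a set -/
def rel (b : Set ℕ) (u v : List ℕ) : Prop := Encodable.encode (u, v) ∈ b

/-- matchings -/
def Mt (B : List ℕ → List ℕ → Prop) : Prop :=
  ∀ u v v', (B u v ∨ B v u) → (B u v' ∨ B v' u) → v = v'

def rb (j : ℕ) (B : List ℕ → List ℕ → Prop) (X : Set ℕ) : Prop :=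
  ∀ u v, dec u → dec v → (∀ a ∈ u, a ∈ X) → (∀ a ∈ v, a ∈ X) → B u v → u.take j = v.take j

theorem rb.sub {j : ℕ} {B : List ℕ → List ℕ → Prop} {X Y : Set ℕ} (h : rb j B X) (hY : Y ⊆ X) :
    rb j B Y := fun u v h1 h2 h3 h4 => h u v h1 h2 (fun a ha => hY (h3 a ha)) (fun a ha => hY (h4 a ha))

theorem dec_cons {a : ℕ} {u : List ℕ} : dec (a :: u) ↔ (∀ b ∈ u, b < a) ∧ dec u := by
  simp [dec]

theorem dec_nil : dec [] := List.Pairwise.nil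

theorem dec_append {E F : List ℕ} (hE : dec E) (hF : dec F) (h : ∀ a ∈ F, ∀ b ∈ E, a < b) :
    dec (E ++ F) := by
  unfold dec
  rw [List.pairwise_append]
  exact ⟨hE, hF, fun a ha b hb => h b hb a ha⟩

theorem dec_split {c : ℕ} {F u : List ℕ} (hc : ∀ a ∈ F, a < c) (hu : dec u) (h : ∀ a ∈ u, a ∈ c :: F) :
    (∀ a ∈ u, a ∈ F) ∨ ∃ u0, u = c :: u0 ∧ dec u0 ∧ ∀ a ∈ u0, a ∈ F := by
  cases u with
  | nil => left; simp
  | cons a t =>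
    rw [dec_cons] at hu
    rcases List.mem_cons.1 (h a List.mem_cons_self) with rfl | ha
    · right
      refine ⟨t, rfl, hu.2, fun b hb => ?_⟩
      rcases List.mem_cons.1 (h b (List.mem_cons_of_mem _ hb)) with rfl | hb'
      · exact absurd (hu.1 b hb) (lt_irrefl _)
      · exact hb'
    · left
      intro b hb
      rcases List.mem_cons.1 hb with rfl | hb'
      · exact ha
      · rcases List.mem_cons.1 (h b hb) with rfl | h2
        · have := hu.1 b hb'; have := hc a ha; omega
        · exact h2

theorem dec_sublist {F : List ℕ} : ∀ {u : List ℕ}, dec F → dec u → (∀ a ∈ u, a ∈ F) → u.Sublist F := by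
  induction F with
  | nil =>
    intro u _ _ h
    cases u with
    | nil => exact List.Sublist.refl _
    | cons a t => exact absurd (h a List.mem_cons_self) (by simp)
  | cons c F ih =>
    intro u hF hu h
    rw [dec_cons] at hF
    rcases dec_split hF.1 hu h with h1 | ⟨u0, rfl, h1, h2⟩
    · exact (ih hF.2 hu h1).cons _
    · exact (ih hF.2 h1 h2).cons_cons _

theorem sublist_dec {F u : List ℕ} (hF : dec F) (h : u.Sublist F) : dec u ∧ ∀ a ∈ u, a ∈ F :=
  ⟨List.Pairwise.sublist h hF, fun _ ha => h.subset ha⟩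

theorem dropfin {B : List ℕ → List ℕ → Prop} (hB : Mt B) {F : List ℕ} (hF : dec F) :
    ∃ m, ∀ c, m ≤ c → ∀ u v, dec u → (∀ a ∈ u, a ∈ F) → (B u v ∨ B v u) → c ∉ v := by
  have h1 : (⋃ u ∈ {u : List ℕ | u ∈ F.sublists}, {v | B u v ∨ B v u}).Finite := by
    apply Set.Finite.biUnion (List.finite_toSet _)
    intro u _
    apply Set.Subsingleton.finite
    intro v hv v' hv'
    exact hB u v v' hv hv'
  have h2 : (⋃ v ∈ (⋃ u ∈ {u : List ℕ | u ∈ F.sublists}, {v | B u v ∨ B v u}), {a : ℕ | a ∈ v}).Finite :=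
    h1.biUnion fun v _ => List.finite_toSet _
  obtain ⟨m, hm⟩ := h2.bddAbove
  refine ⟨m + 1, fun c hc u v hu huF huv hcv => ?_⟩
  have : c ≤ m := hm (by
    simp only [Set.mem_iUnion]
    exact ⟨v, ⟨u, List.mem_sublists.2 (dec_sublist hF hu huF), huv⟩, hcv⟩)
  omega

theorem ext1 {B : List ℕ → List ℕ → Prop} (hB : Mt B) {F : List ℕ} (hF : dec F) (j : ℕ) :
    ∃ m, ∀ c, m ≤ c → (∀ a ∈ F, a < c) ∧ (rb j B (fs F) →
      (∀ u0 v0, dec u0 → dec v0 → (∀ a ∈ u0, a ∈ F) → (∀ a ∈ v0, a ∈ F) → B (c :: u0) (c :: v0) →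
        (c :: u0).take j = (c :: v0).take j) → rb j B (fs (c :: F))) := by
  obtain ⟨m1, h1⟩ := max_list F
  obtain ⟨m2, h2⟩ := dropfin hB hF
  refine ⟨max m1 m2, fun c hc => ?_⟩
  have hcF : ∀ a ∈ F, a < c := fun a ha => lt_of_lt_of_le (h1 a ha) (le_trans (le_max_left _ _) hc)
  refine ⟨hcF, fun h3 h4 u v hu hv hu' hv' huv => ?_⟩
  have hc2 : m2 ≤ c := le_trans (le_max_right _ _) hc
  rcases dec_split hcF hu hu' with p | ⟨u0, rfl, p1, p2⟩ <;>
    rcases dec_split hcF hv hv' with q | ⟨v0, rfl, q1, q2⟩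
  · exact h3 u v hu hv p q huv
  · exact absurd (List.mem_cons_self) (h2 c hc2 u _ hu p (Or.inl huv))
  · exact absurd (List.mem_cons_self) (h2 c hc2 v _ hv q (Or.inr huv))
  · exact h4 u0 v0 p1 q1 p2 q2 huv

/-! primitive recursiveness -/

theorem primrec_dec : PrimrecPred dec := by
  have hlt : PrimrecRel (fun (b : ℕ) (q : ℕ) => b < q) := Primrec.nat_lt
  have h1 : PrimrecPred (fun q : List ℕ × (ℕ × List ℕ × Bool) => ∀ b ∈ q.2.2.1, b < q.2.1) :=
    hlt.forall_mem_list.comp (Primrec.fst.comp (Primrec.snd.comp Primrec.snd))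
      (Primrec.fst.comp Primrec.snd)
  have h2 : Primrec₂ (fun (_ : List ℕ) (p : ℕ × List ℕ × Bool) =>
      (decide (∀ b ∈ p.2.1, b < p.1)) && p.2.2) :=
    Primrec.and.comp (h1.decide.of_eq fun _ => by congr)
      (Primrec.snd.comp (Primrec.snd.comp Primrec.snd))
  have h3 := Primrec.list_rec (f := fun L : List ℕ => L) (g := fun _ => true) Primrec.id
    (Primrec.const _) h2
  have h4 : PrimrecPred (fun L : List ℕ => (List.recOn L true (fun b l IH =>
      (decide (∀ c ∈ l, c < b)) && IH) : Bool) = true) :=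
    Primrec.eq.comp h3 (Primrec.const true)
  refine h4.of_eq fun L => ?_
  induction L with
  | nil => simp [dec]
  | cons a L ih => rw [dec_cons, ← ih]; simp

theorem primrec_subs : Primrec (List.sublists' : List ℕ → List (List ℕ)) := by
  have h2 : Primrec₂ (fun (_ : List ℕ) (p : ℕ × List ℕ × List (List ℕ)) =>
      p.2.2 ++ p.2.2.map (List.cons p.1)) := by
    have hL : Primrec (fun q : List ℕ × (ℕ × List ℕ × List (List ℕ)) => q.2.2.2) :=
      Primrec.snd.comp (Primrec.snd.comp Primrec.snd)
    refine Primrec.list_append.comp hL (Primrec.list_map hL ?_)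
    exact Primrec.list_cons.comp (Primrec.fst.comp (Primrec.snd.comp Primrec.fst)) Primrec.snd
  have h3 := Primrec.list_rec (f := fun L : List ℕ => L) (g := fun _ => [[]]) Primrec.id
    (Primrec.const _) h2
  refine h3.of_eq fun L => ?_
  induction L with
  | nil => rfl
  | cons a L ih => rw [List.sublists'_cons, ← ih]

/-- list version of `rb` -/
def rbl (j : ℕ) (B : List ℕ → List ℕ → Prop) (L : List ℕ) : Prop :=
  ∀ u ∈ L.sublists', ∀ v ∈ L.sublists', B u v → u.take j = v.take j

theorem rbl_iff {j : ℕ} {B : List ℕ → List ℕ → Prop} {L : List ℕ} (hL : dec L) :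
    rbl j B L ↔ rb j B (fs L) := by
  constructor
  · intro h u v hu hv h1 h2 h3
    exact h u (List.mem_sublists'.2 (dec_sublist hL hu h1)) v
      (List.mem_sublists'.2 (dec_sublist hL hv h2)) h3
  · intro h u hu v hv h3
    have h1 := sublist_dec hL (List.mem_sublists'.1 hu)
    have h2 := sublist_dec hL (List.mem_sublists'.1 hv)
    exact h u v h1.1 h2.1 h1.2 h2.2 h3

section
variable {ι : Type} {o : ι → Set ℕ} {b : ι → Set ℕ}

theorem dc_rel (h : Dc o (fun i n => n ∈ b i)) :
    Dc o (fun i (p : List ℕ × List ℕ) => rel (b i) p.1 p.2) :=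
  (h.comp (g := fun p : List ℕ × List ℕ => Encodable.encode p) Primrec.encode)

theorem dc_rbl (h : Dc o (fun i n => n ∈ b i)) (j : ℕ) :
    Dc o (fun i (L : List ℕ) => rbl j (rel (b i)) L) := by
  have t : ∀ j : ℕ, Primrec (fun u : List ℕ => u.take j) := fun j =>
    Primrec.list_take.comp (Primrec.const j) Primrec.id
  have e : PrimrecPred (fun q : (List ℕ × List ℕ) × List ℕ => q.1.2.take j = q.2.take j) :=
    Primrec.eq.comp ((t j).comp (Primrec.snd.comp Primrec.fst)) ((t j).comp Primrec.snd)
  have h1 := ((dc_rel h).comp (g := fun q : (List ℕ × List ℕ) × List ℕ => (q.1.2, q.2))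
    ((Primrec.snd.comp Primrec.fst).pair Primrec.snd)).not.or (Dc.prim e)
  have h2 := Dc.ball (α := List ℕ × List ℕ) (β := List ℕ) (g := fun p => p.1.sublists') h1
    (primrec_subs.comp Primrec.fst)
  have h3 := Dc.ball (α := List ℕ) (β := List ℕ) (g := fun p => p.sublists') h2 primrec_subs
  refine h3.of_eq fun i L => ?_
  unfold rbl
  simp only [imp_iff_not_or]

theorem sg_not_mt (h : Dc o (fun i n => n ∈ b i)) :
    Sg o (fun i (_ : Unit) => ¬ Mt (rel (b i))) := by
  have r1 : Sg o (fun i (q : ((Unit × List ℕ) × List ℕ) × List ℕ) => rel (b i) q.1.1.2 q.1.2 ∨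
      rel (b i) q.1.2 q.1.1.2) := by
    have pu : Primrec (fun q : ((Unit × List ℕ) × List ℕ) × List ℕ => q.1.1.2) :=
      Primrec.snd.comp (Primrec.fst.comp Primrec.fst)
    have pv : Primrec (fun q : ((Unit × List ℕ) × List ℕ) × List ℕ => q.1.2) :=
      Primrec.snd.comp Primrec.fst
    exact ((dc_rel h).1.comp (pu.pair pv)).or ((dc_rel h).1.comp (pv.pair pu))
  have r2 : Sg o (fun i (q : ((Unit × List ℕ) × List ℕ) × List ℕ) => rel (b i) q.1.1.2 q.2 ∨
      rel (b i) q.2 q.1.1.2) := by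
    have pu : Primrec (fun q : ((Unit × List ℕ) × List ℕ) × List ℕ => q.1.1.2) :=
      Primrec.snd.comp (Primrec.fst.comp Primrec.fst)
    have pv : Primrec (fun q : ((Unit × List ℕ) × List ℕ) × List ℕ => q.2) :=
      Primrec.snd
    exact ((dc_rel h).1.comp (pu.pair pv)).or ((dc_rel h).1.comp (pv.pair pu))
  have r3 : PrimrecPred (fun q : ((Unit × List ℕ) × List ℕ) × List ℕ => ¬ q.1.2 = q.2) :=
    PrimrecPred.not (Primrec.eq.comp (Primrec.snd.comp Primrec.fst) Primrec.snd)
  refine ((r1.and (r2.and (Sg.prim r3))).ex.ex.ex).of_eq fun i _ => ?_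
  unfold Mt
  push Not
  rfl

end

def Sj (j : ℕ) : Prop := ∀ (W Z : Set ℕ) (B : List ℕ → List ℕ → Prop) (F : List ℕ) (R : Set ℕ),
  Mt B → dec F → (∀ a ∈ F, ∀ c ∈ R, a < c) → gr W Z R → (∀ c ∈ R, rb j B (fs (c :: F))) →
  ∃ X ⊆ R, gr W Z X ∧ rb j B (fs F ∪ X)

def NSj (j : ℕ) : Prop := ∀ (W Z b : Set ℕ) (F : List ℕ) (R : Set ℕ),
  Mt (rel b) → dec F → (∀ a ∈ F, ∀ c ∈ R, a < c) → gr W (join b Z) R →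
  (∀ c ∈ R, rb j (rel b) (fs (c :: F))) → (j ≤ 2 ∨ F = []) →
  ∃ X ⊆ R, gr W (join b Z) X ∧ rb j (rel b) (fs F ∪ X)

theorem rb_zero (B : List ℕ → List ℕ → Prop) (X : Set ℕ) : rb 0 B X := by
  intro u v _ _ _ _ _; simp

theorem S_zero : Sj 0 := fun _ _ _ _ R _ _ _ h _ => ⟨R, fun _ h => h, h, rb_zero _ _⟩

theorem NS_zero : NSj 0 := fun _ _ _ _ R _ _ _ h _ _ => ⟨R, fun _ h => h, h, rb_zero _ _⟩

/-- uniform eventual behaviour for finitely many pairs -/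
theorem unif {C : Set ℕ} {A : List ℕ × List ℕ → Set ℕ}
    (h : ∀ k, ∃ m, (∀ a ∈ C, m ≤ a → a ∈ A k) ∨ (∀ a ∈ C, m ≤ a → a ∉ A k)) (L : List ℕ) :
    ∃ m, ∀ u v, u.Sublist L → v.Sublist L → ∀ a ∈ C, m ≤ a → a ∈ A (u, v) →
      ∀ c ∈ C, m ≤ c → c ∈ A (u, v) := by
  choose f hf using h
  let s := (L.sublists.product L.sublists).toFinset
  refine ⟨s.sup f, fun u v hu hv a ha hma haA c hc hmc => ?_⟩
  have hs : (u, v) ∈ s := by simp [s, hu, hv]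
  have hle : f (u, v) ≤ s.sup f := Finset.le_sup hs
  rcases hf (u, v) with h | h
  · exact h c hc (hle.trans hmc)
  · exact absurd haA (h a ha (hle.trans hma))

theorem NS_succ {j : ℕ} (hS : Sj j) : NSj (j + 1) := by
  intro W Z b F R hM hF hFR hR hrb hj
  set Zt := join b Z with hZt
  obtain ⟨C, hCR, hC, hcoh⟩ := coh hR (fun p : List ℕ × List ℕ => {x | rel b (x :: p.1) (x :: p.2)})
  let M : List ℕ → List ℕ → Prop := fun u v => ∃ m, ∀ a ∈ C, m ≤ a → rel b (a :: u) (a :: v)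
  have hMM : Mt M := by
    have q : ∀ u v, (M u v ∨ M v u) → ∃ m, ∀ a ∈ C, m ≤ a →
        (rel b (a :: u) (a :: v) ∨ rel b (a :: v) (a :: u)) := by
      rintro u v (⟨m, h⟩ | ⟨m, h⟩)
      · exact ⟨m, fun a ha hm => Or.inl (h a ha hm)⟩
      · exact ⟨m, fun a ha hm => Or.inr (h a ha hm)⟩
    intro u v v' h1 h2
    obtain ⟨m1, h1⟩ := q _ _ h1
    obtain ⟨m2, h2⟩ := q _ _ h2
    obtain ⟨a, ha, hm⟩ := inf_ge_mem hC.1 (max m1 m2)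
    have := hM _ _ _ (h1 a ha (le_trans (le_max_left _ _) hm)) (h2 a ha (le_trans (le_max_right _ _) hm))
    simpa using this
  -- `M` on `F`
  have hMF : rb j M (fs F) := by
    intro u v hu hv huF hvF ⟨m, h⟩
    obtain ⟨a, ha, hm⟩ := inf_ge_mem hC.1 m
    have haF : ∀ c ∈ F, c < a := fun c hc => hFR c hc a (hCR ha)
    have := hrb a (hCR ha) (a :: u) (a :: v) (dec_cons.2 ⟨fun c hc => haF c (huF c hc), hu⟩)
      (dec_cons.2 ⟨fun c hc => haF c (hvF c hc), hv⟩)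
      (by
        intro c hc
        rcases List.mem_cons.1 hc with rfl | hc
        · exact List.mem_cons_self
        · exact List.mem_cons_of_mem _ (huF c hc))
      (by
        intro c hc
        rcases List.mem_cons.1 hc with rfl | hc
        · exact List.mem_cons_self
        · exact List.mem_cons_of_mem _ (hvF c hc)) (h a ha hm)
    simpa using this
  obtain ⟨m0, hm0⟩ := ext1 hMM hF j
  obtain ⟨X, hXC, hX, hXrb⟩ := hS W Zt M F {a | a ∈ C ∧ m0 ≤ a} hMM hF
    (fun a ha c hc => hFR a ha c (hCR hc.1)) (hC.ge m0) (by
      intro c hc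
      refine (hm0 c hc.2).2 hMF ?_
      intro u0 v0 hu hv hu' hv' _
      rcases hj with hj | rfl
      · have : j = 0 ∨ j = 1 := by omega
        rcases this with rfl | rfl <;> simp
      · have e1 : u0 = [] := List.eq_nil_iff_forall_not_mem.2 fun a ha => by simpa using hu' a ha
        have e2 : v0 = [] := List.eq_nil_iff_forall_not_mem.2 fun a ha => by simpa using hv' a ha
        rw [e1, e2])
  have hXC' : X ⊆ C := fun a ha => (hXC ha).1
  -- Cohen forcing
  let cond : List ℕ → Set ℕ → Prop := fun F' R' => dec F' ∧ (∀ a ∈ F', ∀ c ∈ R', a < c) ∧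
    (∀ a ∈ F', a ∈ F ∨ a ∈ X) ∧ rb (j + 1) (rel b) (fs F') ∧ ∃ l, R' = {a | a ∈ X ∧ l ≤ a}
  obtain ⟨G, hFG, hGR, hreq, hfin⟩ := mathias (κ := ℕ ⊕ Fn) cond
    (fun i G => match i with
      | Sum.inl n => ∃ a ∈ G, n ≤ a
      | Sum.inr T => rb (j + 1) (rel b) G → ¬ Comp T (join G Zt) W)
    (by
      rintro (n | T) F' R' ⟨h1, h2, h3, h4, l, rfl⟩
      · obtain ⟨m1, hm1⟩ := ext1 hM h1 (j + 1)
        obtain ⟨m2, hm2⟩ := unif hcoh F'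
        obtain ⟨a, ha, hma⟩ := inf_ge_mem hX.1 (max (max l n) (max m1 m2))
        have g1 : l ≤ a := by omega
        have g2 : n ≤ a := by omega
        have g3 : m1 ≤ a := by omega
        have g4 : m2 ≤ a := by omega
        refine ⟨[a], {c | c ∈ X ∧ a + 1 ≤ c}, by simp [ha, g1], fun c hc => ⟨hc.1, by
          have := hc.2; omega⟩, ⟨?_, ?_, ?_, ?_, _, rfl⟩, fun G h _ => ⟨a, h a (by simp), g2⟩⟩
        · exact dec_cons.2 ⟨(hm1 a g3).1, h1⟩
        · intro c hc d hd
          have := hd.2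
          rcases List.mem_cons.1 hc with rfl | hc
          · omega
          · have := (hm1 a g3).1 c hc; omega
        · intro c hc
          rcases List.mem_cons.1 hc with rfl | hc
          · exact Or.inr ha
          · exact h3 c hc
        · refine (hm1 a g3).2 h4 ?_
          intro u0 v0 hu hv hu' hv' huv
          have hMuv : M u0 v0 := ⟨m2, fun c hc hmc => hm2 u0 v0 (dec_sublist h1 hu hu')
            (dec_sublist h1 hv hv') a (hXC' ha) g4 huv c hc hmc⟩
          have := hXrb u0 v0 hu hv (fun c hc => h3 c (hu' c hc)) (fun c hc => h3 c (hv' c hc)) hMuv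
          simp [this]
      · have oX : Dc (fun _ : Unit => join X Zt) (fun _ n => n ∈ X) :=
          Dc.left (A := fun _ => X) (B := fun _ => Zt) Dc.self
        have oZ : Dc (fun _ : Unit => join X Zt) (fun _ n => n ∈ Zt) :=
          Dc.right (A := fun _ => X) (B := fun _ => Zt) Dc.self
        have ob : Dc (fun _ : Unit => join X Zt) (fun _ n => n ∈ b) :=
          Dc.left (A := fun _ => b) (B := fun _ => Z) oZ
        have ap : Primrec (fun E : List ℕ => E ++ F') :=
          Primrec.list_append.comp Primrec.id (Primrec.const _)
        have pl0 : PrimrecRel (fun (a : ℕ) (c : ℕ) => c ≤ a) :=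
          Primrec.nat_le.comp Primrec.snd Primrec.fst
        have pl : PrimrecPred (fun E : List ℕ => ∀ a ∈ E, l ≤ a) :=
          pl0.forall_mem_list.comp Primrec.id (Primrec.const l)
        have hD := ((dc_subset oX).and (Dc.prim pl)).1.and
          ((Sg.prim (primrec_dec.comp ap)).and ((dc_rbl ob (j + 1)).1.comp ap))
        rcases gamma hX.2 oZ T F' hD with ⟨w, E, ⟨⟨q1, q1'⟩, q2⟩, q3⟩ | ⟨w, h⟩
        · obtain ⟨l', hl'⟩ := wrong q3
          obtain ⟨m, hm⟩ := max_list (E ++ F')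
          refine ⟨E, {a | a ∈ X ∧ max l (max l' m) ≤ a}, fun a ha => ⟨q1 a ha, q1' a ha⟩,
            fun a ha => ⟨ha.1, by have := ha.2; omega⟩, ⟨q2.1, ?_, ?_, (rbl_iff q2.1).1 q2.2, _, rfl⟩, ?_⟩
          · intro a ha c hc
            have := hm a ha
            have := hc.2
            omega
          · intro a ha
            rcases List.mem_append.1 ha with ha | ha
            · exact Or.inr (q1 a ha)
            · exact h3 a ha
          · intro G g1 g2 _
            refine hl' G g1 fun a ha => (g2 a ha).imp id fun h => ?_
            have := h.2; omega
        · refine ⟨[], _, by simp, fun _ h => h, ⟨h1, h2, h3, h4, l, rfl⟩, fun G g1 g2 hG =>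
            never (F := F') (w := w) g1 ?_⟩
          intro E hE hEG
          have e1 : ∀ a ∈ E, a ∈ X ∧ l ≤ a := fun a ha =>
            (g2 a (hEG a ha).1).resolve_left (hEG a ha).2
          have e2 : dec (E ++ F') := dec_append hE h1 fun a ha c hc => h2 a ha c (e1 c hc)
          refine h E ⟨⟨fun a ha => (e1 a ha).1, fun a ha => (e1 a ha).2⟩, e2, (rbl_iff e2).2 (hG.sub ?_)⟩
          intro a ha
          rcases List.mem_append.1 ha with ha | ha
          · exact (hEG a ha).1
          · exact g1 a ha) F X
    ⟨hF, fun a ha c hc => hFR a ha c (hCR (hXC' hc)), fun a ha => Or.inl ha, by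
      obtain ⟨a, ha⟩ := hR.1.nonempty
      exact (hrb a ha).sub fun c hc => List.mem_cons_of_mem _ hc, 0, by simp⟩
  have hGrb : rb (j + 1) (rel b) G := by
    intro u v hu hv hu' hv' huv
    obtain ⟨F', R', ⟨-, -, -, h4, -⟩, h5, -, -⟩ := hfin (u ++ v) (by
      intro a ha
      rcases List.mem_append.1 ha with ha | ha
      · exact hu' a ha
      · exact hv' a ha)
    exact h4 u v hu hv (fun a ha => h5 a (by simp [ha])) (fun a ha => h5 a (by simp [ha])) huv
  have hGgr : gr W Zt G := by
    refine ⟨inf_of_ge fun n => hreq (Sum.inl n), ?_⟩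
    rintro ⟨T, hT⟩
    exact hreq (Sum.inr T) hGrb hT
  obtain ⟨m, hm⟩ := max_list F
  refine ⟨{a | a ∈ G ∧ m ≤ a}, ?_, hGgr.ge m, hGrb.sub ?_⟩
  · rintro a ⟨ha, hma⟩
    rcases hGR a ha with h | h
    · have := hm a h; omega
    · exact hCR (hXC' h)
  · rintro a (ha | ha)
    · exact hFG a ha
    · exact ha.1

def ev0 (x : Set ℕ) : Set ℕ := {n | 2 * n ∈ x}
def ev1 (x : Set ℕ) : Set ℕ := {n | 2 * n + 1 ∈ x}

theorem ev0_join (A B : Set ℕ) : ev0 (join A B) = A := by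
  ext n; exact mem_join_even
theorem ev1_join (A B : Set ℕ) : ev1 (join A B) = B := by
  ext n; exact mem_join_odd

structure valid (F : List ℕ) (R : Set ℕ) (k : ℕ) (x : Set ℕ) : Prop where
  m0 : Mt (rel (ev0 x))
  m1 : Mt (rel (ev1 x))
  r0 : ∀ c ∈ R, rbl (k + 1) (rel (ev0 x)) (c :: F)
  r1 : rbl k (rel (ev1 x)) F

def good (F : List ℕ) (R : Set ℕ) (k : ℕ) (x : Set ℕ) (E : List ℕ) : Prop :=
  (∀ a ∈ E, a ∈ R) ∧ dec (E ++ F) ∧ rbl (k + 1) (rel (ev0 x)) (E ++ F) ∧ rbl k (rel (ev1 x)) (E ++ F)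

section
variable (F : List ℕ) (R Z : Set ℕ) (k : ℕ)

theorem dcx : Dc (fun x => join x (join R Z)) (fun x n => n ∈ x) :=
  Dc.left (A := fun x => x) (B := fun _ => join R Z) Dc.self
theorem dcRZ : Dc (fun x => join x (join R Z)) (fun _ n => n ∈ join R Z) :=
  Dc.right (A := fun x => x) (B := fun _ => join R Z) Dc.self
theorem dcR : Dc (fun x => join x (join R Z)) (fun _ n => n ∈ R) :=
  Dc.left (A := fun _ => R) (B := fun _ => Z) (dcRZ R Z)
theorem dcZ : Dc (fun x => join x (join R Z)) (fun _ n => n ∈ Z) :=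
  Dc.right (A := fun _ => R) (B := fun _ => Z) (dcRZ R Z)
theorem dc0 : Dc (fun x => join x (join R Z)) (fun x n => n ∈ ev0 x) :=
  (dcx R Z).comp Primrec.nat_double
theorem dc1 : Dc (fun x => join x (join R Z)) (fun x n => n ∈ ev1 x) :=
  (dcx R Z).comp Primrec.nat_double_succ

theorem sg_invalid : Sg (fun x => join x (join R Z)) (fun x (_ : Unit) => ¬ valid F R k x) := by
  have h3 := ((dcR R Z).1.comp (g := fun p : Unit × ℕ => p.2) Primrec.snd).and
    ((dc_rbl (dc0 R Z) (k + 1)).2.comp (g := fun p : Unit × ℕ => p.2 :: F)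
      (Primrec.list_cons.comp Primrec.snd (Primrec.const _)))
  have h4 := (dc_rbl (dc1 R Z) k).2.comp (g := fun _ : Unit => F) (Primrec.const _)
  refine ((((sg_not_mt (dc0 R Z)).or (sg_not_mt (dc1 R Z))).or h3.ex).or h4).of_eq fun x _ => ?_
  constructor
  · rintro (((h | h) | ⟨c, h, h'⟩) | h) hv
    · exact h hv.m0
    · exact h hv.m1
    · exact h' (hv.r0 c h)
    · exact h hv.r1
  · intro h
    by_contra hc
    push Not at hc
    exact h ⟨hc.1.1.1, hc.1.1.2, fun c hcR => hc.1.2 c hcR, hc.2⟩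

theorem sg_good : Sg (fun x => join x (join R Z)) (fun x E => good F R k x E) := by
  have ap : Primrec (fun E : List ℕ => E ++ F) :=
    Primrec.list_append.comp Primrec.id (Primrec.const _)
  exact (dc_subset (dcR R Z)).1.and ((Sg.prim (primrec_dec.comp ap)).and
    (((dc_rbl (dc0 R Z) (k + 1)).1.comp ap).and ((dc_rbl (dc1 R Z) k).1.comp ap)))

theorem sg_V (T : Fn) : Sg (fun x => join x (join R Z)) (fun x (p : ℕ × Bool) => ¬ valid F R k x ∨
    ∃ E, good F R k x E ∧ Ev T (join (fs (E ++ F)) Z) p.1 p.2) := by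
  have hJ : Dc (fun x => join x (join R Z)) (fun _ (p : List ℕ × ℕ) => p.2 ∈ join (fs (p.1 ++ F)) Z) :=
    Dc.join (A := fun _ E => fs (E ++ F)) (B := fun _ _ => Z)
      (Dc.fs (Primrec.list_append.comp Primrec.id (Primrec.const _))) ((dcZ R Z).comp Primrec.snd)
  have hE := (sg_ev T (h := fun _ (E : List ℕ) => join (fs (E ++ F)) Z) hJ).comp
    (g := fun p : (ℕ × Bool) × List ℕ => (p.2, p.1)) (Primrec.snd.pair Primrec.fst)
  have hG := (sg_good F R Z k).comp (g := fun p : (ℕ × Bool) × List ℕ => p.2) Primrec.snd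
  exact ((sg_invalid F R Z k).comp (g := fun _ : ℕ × Bool => ()) (Primrec.const _)).or (hG.and hE).ex
end

/-- forcing conditions for the strong theorem -/
structure cnd (W Z : Set ℕ) (k : ℕ) (B : List ℕ → List ℕ → Prop) (F : List ℕ) (R : Set ℕ) : Prop where
  d : dec F
  lt : ∀ a ∈ F, ∀ c ∈ R, a < c
  g : gr W Z R
  r : ∀ c ∈ R, rb (k + 1) B (fs (c :: F))

theorem cnd.sub {W Z : Set ℕ} {k : ℕ} {B : List ℕ → List ℕ → Prop} {F : List ℕ} {R R' : Set ℕ}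
    (h : cnd W Z k B F R) (hR : R' ⊆ R) (hg : gr W Z R') : cnd W Z k B F R' :=
  ⟨h.d, fun a ha c hc => h.lt a ha c (hR hc), hg, fun c hc => h.r c (hR hc)⟩

theorem cnd.rF {W Z : Set ℕ} {k : ℕ} {B : List ℕ → List ℕ → Prop} {F : List ℕ} {R : Set ℕ}
    (h : cnd W Z k B F R) : rb (k + 1) B (fs F) := by
  obtain ⟨a, ha⟩ := h.g.1.nonempty
  exact (h.r a ha).sub fun c hc => List.mem_cons_of_mem _ hc

theorem rel_set (B : List ℕ → List ℕ → Prop) :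
    ∃ b : Set ℕ, rel b = B := by
  refine ⟨{n | ∃ u v, n = Encodable.encode (u, v) ∧ B u v}, ?_⟩
  funext u v
  apply propext
  constructor
  · rintro ⟨u', v', h, h'⟩
    have := Encodable.encode_injective h
    simp only [Prod.mk.injEq] at this
    rw [this.1, this.2]; exact h'
  · intro h; exact ⟨u, v, rfl, h⟩

theorem force_open {W Z : Set ℕ} {k : ℕ} {B : List ℕ → List ℕ → Prop} {F : List ℕ} {R : Set ℕ}
    (hB : Mt B) (h : cnd W Z k B F R) (Q : List ℕ → Prop)
    (hQ : ∀ x, valid F R k x → ∃ E, good F R k x E ∧ Q E) :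
    ∃ E R', (∀ a ∈ E, a ∈ R) ∧ R' ⊆ R ∧ Q E ∧ cnd W Z k B (E ++ F) R' := by
  obtain ⟨s, hs⟩ := cover (κ := Option (List ℕ))
    (fun q x => match q with
      | none => ¬ valid F R k x
      | some E => good F R k x E ∧ Q E)
    (by
      rintro (_ | E)
      · exact (sg_invalid F R Z k).opn ()
      · intro x hx
        obtain ⟨l, hl⟩ := (sg_good F R Z k).opn E x hx.1
        exact ⟨l, fun y hy => ⟨hl y hy, hx.2⟩⟩)
    (by
      intro x
      by_cases hv : valid F R k x
      · obtain ⟨E, hE⟩ := hQ x hv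
        exact ⟨some E, hE⟩
      · exact ⟨none, hv⟩)
  obtain ⟨b, hb⟩ := rel_set B
  have hM : ∀ c, ∃ M : Set ℕ, rel M = fun u v => B (c :: u) (c :: v) := fun c => rel_set _
  choose M hM using hM
  have hval : ∀ c ∈ R, valid F R k (join b (M c)) := by
    intro c hc
    have hcF : ∀ a ∈ F, a < c := fun a ha => h.lt a ha c hc
    refine ⟨?_, ?_, ?_, ?_⟩
    · rw [ev0_join, hb]; exact hB
    · rw [ev1_join, hM]
      intro u v v' h1 h2
      have := hB _ _ _ h1 h2
      simpa using this
    · intro d hd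
      rw [ev0_join, hb, rbl_iff (dec_cons.2 ⟨fun a ha => h.lt a ha d hd, h.d⟩)]
      exact h.r d hd
    · rw [ev1_join, hM, rbl_iff h.d]
      intro u v hu hv hu' hv' huv
      have sub : ∀ t : List ℕ, (∀ a ∈ t, a ∈ fs F) → ∀ a ∈ c :: t, a ∈ fs (c :: F) := by
        intro t ht a ha
        rcases List.mem_cons.1 ha with rfl | ha
        · exact List.mem_cons_self
        · exact List.mem_cons_of_mem _ (ht a ha)
      have := h.r c hc (c :: u) (c :: v) (dec_cons.2 ⟨fun a ha => hcF a (hu' a ha), hu⟩)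
        (dec_cons.2 ⟨fun a ha => hcF a (hv' a ha), hv⟩) (sub u hu') (sub v hv') huv
      simpa using this
  obtain ⟨q, hq, R', h1, h2, h3⟩ := ph_fin (fun q c => match q with
      | none => ¬ valid F R k (join b (M c))
      | some E => good F R k (join b (M c)) E ∧ Q E) s h.g (fun c hc => by
        obtain ⟨q, hq, h⟩ := hs (join b (M c))
        exact ⟨q, hq, by cases q <;> exact h⟩)
  obtain ⟨c0, hc0⟩ := h2.1.nonempty
  rcases q with _ | E
  · exact absurd (hval c0 (h1 hc0)) (h3 c0 hc0)
  · obtain ⟨⟨g1, g2, g3, -⟩, hQE⟩ := h3 c0 hc0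
    rw [ev0_join, hb, rbl_iff g2] at g3
    obtain ⟨m, hm⟩ := ext1 hB g2 (k + 1)
    refine ⟨E, {a | a ∈ R' ∧ m ≤ a}, g1, fun a ha => h1 ha.1, hQE, g2,
      fun a ha c hc => (hm c hc.2).1 a ha, h2.ge m, fun c hc => (hm c hc.2).2 g3 ?_⟩
    intro u0 v0 hu hv hu' hv' huv
    obtain ⟨⟨-, -, -, g4⟩, -⟩ := h3 c hc.1
    rw [ev1_join, hM, rbl_iff g2] at g4
    have := g4 u0 v0 hu hv hu' hv' huv
    simp [this]

theorem S_succ {k : ℕ} (hk : k ≤ 1) (hN1 : NSj (k + 1)) (hN0 : NSj k) : Sj (k + 1) := by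
  intro W Z B F R hB hF hFR hR hrb
  obtain ⟨G, hFG, hGR, hreq, hfin⟩ := mathias (κ := ℕ ⊕ Fn) (cnd W Z k B)
    (fun i G => match i with
      | Sum.inl n => ∃ a ∈ G, n ≤ a
      | Sum.inr T => ¬ Comp T (join G Z) W)
    (by
      rintro (n | T) F R h
      · obtain ⟨E, R', h1, h2, ⟨a, haE, hna⟩, h4⟩ := force_open hB h (fun E => ∃ a ∈ E, n ≤ a) (by
          intro x hx
          obtain ⟨m, hm⟩ := ext1 hx.m1 h.d k
          obtain ⟨c, hc, hmc⟩ := inf_ge_mem h.g.1 (max m n)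
          have d1 : dec (c :: F) := dec_cons.2 ⟨fun a ha => h.lt a ha c hc, h.d⟩
          refine ⟨[c], ⟨by simp [hc], d1, hx.r0 c hc, ?_⟩, c, by simp, by omega⟩
          refine (rbl_iff d1).2 ((hm c (by omega)).2 ((rbl_iff h.d).1 hx.r1) ?_)
          intro u0 v0 _ _ _ _ _
          have : k = 0 ∨ k = 1 := by omega
          rcases this with rfl | rfl <;> simp)
        exact ⟨E, R', h1, h2, h4, fun G hG _ => ⟨a, hG a (by simp [haE]), hna⟩⟩
      · rcases lmain h.g.2 (sg_V F R Z k T) with ⟨w, hw⟩ | ⟨w, x, hw, hx⟩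
        · obtain ⟨E, R', h1, h2, h3, h4⟩ := force_open hB h
            (fun E => Ev T (join (fs (E ++ F)) Z) w (!val W w)) (fun x hx =>
              (hw x).resolve_left (not_not.2 hx))
          obtain ⟨l, hl⟩ := wrong h3
          exact ⟨E, {a | a ∈ R' ∧ l ≤ a}, h1, fun a ha => h2 ha.1, h4.sub (fun a ha => ha.1) (h4.g.ge l),
            fun G g1 g2 => hl G g1 fun a ha => (g2 a ha).imp id fun h => h.2⟩
        · push Not at hw
          obtain ⟨hv, hw⟩ := hw
          have o1 : ∀ {α : Type} [Primcodable α] {V : Set ℕ → α → Prop},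
              Dc (fun x => join x (join R Z)) V →
              Dc (fun _ : Unit => join x (join R Z)) (fun _ a => V x a) := by
            rintro α _ V ⟨⟨T, hT, h1⟩, ⟨T', hT', h1'⟩⟩
            exact ⟨⟨T, hT, fun _ a => h1 x a⟩, ⟨T', hT', fun _ a => h1' x a⟩⟩
          have oR := o1 (dcR R Z)
          have oZ := o1 (dcZ R Z)
          have o0 := o1 (dc0 R Z)
          have o1 := o1 (dc1 R Z)
          have oZ1 := Dc.join' (A := fun _ => ev1 x) (B := fun _ => Z) o1 oZ
          have oZ2 := Dc.join' (A := fun _ => ev0 x) (B := fun _ => join (ev1 x) Z) o0 oZ1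
          obtain ⟨R1, hR1, hg1, hr1⟩ := hN1 W (join (ev1 x) Z) (ev0 x) F R hv.m0 h.d h.lt
            ⟨h.g.1, red_mono oR oZ2 hx⟩ (fun c hc =>
              (rbl_iff (dec_cons.2 ⟨fun a ha => h.lt a ha c hc, h.d⟩)).1 (hv.r0 c hc))
            (Or.inl (by omega))
          obtain ⟨m, hm⟩ := ext1 hv.m1 h.d k
          have hg1' := hg1.ge m
          -- change of base
          have hg1'' : gr W (join (ev1 x) (join (ev0 x) Z)) {a | a ∈ R1 ∧ m ≤ a} := by
            refine ⟨hg1'.1, ?_⟩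
            have p0 : Dc (fun _ : Unit => join {a | a ∈ R1 ∧ m ≤ a} (join (ev0 x) (join (ev1 x) Z)))
              (fun _ n => n ∈ join {a | a ∈ R1 ∧ m ≤ a} (join (ev0 x) (join (ev1 x) Z))) := Dc.self
            have p1 := Dc.left (A := fun _ => {a | a ∈ R1 ∧ m ≤ a})
              (B := fun _ => (join (ev0 x) (join (ev1 x) Z))) p0
            have p2 := Dc.right (A := fun _ => {a | a ∈ R1 ∧ m ≤ a})
              (B := fun _ => (join (ev0 x) (join (ev1 x) Z))) p0
            have p3 := Dc.left (A := fun _ => ev0 x) (B := fun _ => join (ev1 x) Z) p2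
            have p4 := Dc.right (A := fun _ => ev0 x) (B := fun _ => join (ev1 x) Z) p2
            have p5 := Dc.left (A := fun _ => ev1 x) (B := fun _ => Z) p4
            have p6 := Dc.right (A := fun _ => ev1 x) (B := fun _ => Z) p4
            exact red_mono p1 (Dc.join' (A := fun _ => ev1 x) (B := fun _ => join (ev0 x) Z) p5
              (Dc.join' (A := fun _ => ev0 x) (B := fun _ => Z) p3 p6)) hg1'.2
          obtain ⟨R2, hR2, hg2, hr2⟩ := hN0 W (join (ev0 x) Z) (ev1 x) F _ hv.m1 h.d
            (fun a ha c hc => h.lt a ha c (hR1 hc.1)) hg1'' (fun c hc =>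
              (hm c hc.2).2 ((rbl_iff h.d).1 hv.r1) (by
                intro u0 v0 _ _ _ _ _
                have : k = 0 ∨ k = 1 := by omega
                rcases this with rfl | rfl <;> simp)) (Or.inl (by omega))
          have hR2R : R2 ⊆ R := fun a ha => hR1 (hR2 ha).1
          have hg3 : gr W Z R2 := by
            refine ⟨hg2.1, ?_⟩
            have p0 : Dc (fun _ : Unit => join R2 (join (ev1 x) (join (ev0 x) Z)))
              (fun _ n => n ∈ join R2 (join (ev1 x) (join (ev0 x) Z))) := Dc.self
            have p1 := Dc.left (A := fun _ => R2) (B := fun _ => (join (ev1 x) (join (ev0 x) Z))) p0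
            have p2 := Dc.right (A := fun _ => R2) (B := fun _ => (join (ev1 x) (join (ev0 x) Z))) p0
            have p4 := Dc.right (A := fun _ => ev1 x) (B := fun _ => join (ev0 x) Z) p2
            have p6 := Dc.right (A := fun _ => ev0 x) (B := fun _ => Z) p4
            exact red_mono p1 p6 hg2.2
          refine ⟨[], R2, by simp, hR2R, h.sub hR2R hg3, fun G g1 g2 => never (F := F) (w := w) g1 ?_⟩
          intro E hE hEG
          have e1 : ∀ a ∈ E, a ∈ R2 := fun a ha =>
            (g2 a (hEG a ha).1).resolve_left (hEG a ha).2
          have e2 : dec (E ++ F) := dec_append hE h.d fun a ha c hc => h.lt a ha c (hR2R (e1 c hc))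
          have e3 : fs (E ++ F) ⊆ fs F ∪ R2 := by
            intro a ha
            rcases List.mem_append.1 ha with ha | ha
            · exact Or.inr (e1 a ha)
            · exact Or.inl ha
          refine hw E ⟨fun a ha => hR2R (e1 a ha), e2, (rbl_iff e2).2 (hr1.sub ?_),
            (rbl_iff e2).2 (hr2.sub e3)⟩
          intro a ha
          exact (e3 ha).imp id fun h => (hR2 h).1) F R ⟨hF, hFR, hR, hrb⟩
  have hGrb : rb (k + 1) B G := by
    intro u v hu hv hu' hv' huv
    obtain ⟨F', R', h4, h5, -, -⟩ := hfin (u ++ v) (by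
      intro a ha
      rcases List.mem_append.1 ha with ha | ha
      · exact hu' a ha
      · exact hv' a ha)
    exact h4.rF u v hu hv (fun a ha => h5 a (by simp [ha])) (fun a ha => h5 a (by simp [ha])) huv
  have hGgr : gr W Z G := by
    refine ⟨inf_of_ge fun n => hreq (Sum.inl n), ?_⟩
    rintro ⟨T, hT⟩
    exact hreq (Sum.inr T) hT
  obtain ⟨m, hm⟩ := max_list F
  refine ⟨{a | a ∈ G ∧ m ≤ a}, ?_, hGgr.ge m, hGrb.sub ?_⟩
  · rintro a ⟨ha, hma⟩
    rcases hGR a ha with h | h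
    · have := hm a h; omega
    · exact h
  · rintro a (ha | ha)
    · exact hFG a ha
    · exact ha.1

theorem NS_three : NSj 3 := by
  have n1 : NSj 1 := NS_succ S_zero
  have s1 : Sj 1 := S_succ (by omega) n1 NS_zero
  have n2 : NSj 2 := NS_succ s1
  have s2 : Sj 2 := S_succ (by omega) n2 n1
  exact NS_succ s2

theorem rec_of_partrec {O f : ℕ →. ℕ} (h : Nat.Partrec f) : RecursiveIn O f := by
  induction h with
  | zero => exact RecursiveIn.zero
  | succ => exact RecursiveIn.succ
  | left => exact RecursiveIn.left
  | right => exact RecursiveIn.right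
  | pair _ _ h1 h2 => exact RecursiveIn.pair h1 h2
  | comp _ _ h1 h2 => exact RecursiveIn.comp h1 h2
  | prec _ _ h1 h2 => exact RecursiveIn.prec h1 h2
  | rfind _ h1 => exact RecursiveIn.rfind h1

theorem FunRecIn.prim {O : Set ℕ} {f : ℕ → ℕ} (h : Primrec f) : FunRecIn O f :=
  rec_of_partrec (Nat.Partrec.of_primrec (Primrec.nat_iff.1 h))

theorem FunRecIn.comp {O : Set ℕ} {f g : ℕ → ℕ} (hf : FunRecIn O f) (hg : FunRecIn O g) :
    FunRecIn O (fun n => f (g n)) := by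
  have := RecursiveIn.comp hf hg
  unfold FunRecIn
  refine (congrArg (RecursiveIn _) ?_).mp this
  funext n
  exact Part.bind_some _ _

theorem FunRecIn.pair {O : Set ℕ} {f g : ℕ → ℕ} (hf : FunRecIn O f) (hg : FunRecIn O g) :
    FunRecIn O (fun n => Nat.pair (f n) (g n)) := by
  have := RecursiveIn.pair hf hg
  unfold FunRecIn
  refine (congrArg (RecursiveIn _) ?_).mp this
  funext n
  simp [Seq.seq]

theorem FunRecIn.oracle {O : Set ℕ} : FunRecIn O (chi O) := RecursiveIn.oracle

theorem FunRecIn.prec {O : Set ℕ} {g : ℕ → ℕ} (a : ℕ) (hg : FunRecIn O g) :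
    FunRecIn O (fun n => n.rec a (fun y i => g (Nat.pair y i))) := by
  have h0 : FunRecIn O (fun _ => a) := FunRecIn.prim (Primrec.const a)
  have h1 : FunRecIn O (fun m => g m.unpair.2) :=
    hg.comp (FunRecIn.prim (Primrec.snd.comp Primrec.unpair))
  have h2 := RecursiveIn.prec h0 h1
  have h3 : FunRecIn O (fun n => Nat.pair 0 n) :=
    FunRecIn.prim (Primrec₂.natPair.comp (Primrec.const 0) Primrec.id)
  have h4 := RecursiveIn.comp h2 h3
  unfold FunRecIn
  refine (congrArg (RecursiveIn _) ?_).mp h4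
  symm
  funext n
  simp only [PFun.coe_val, Part.bind_eq_bind, Part.bind_some, Nat.unpaired, Nat.unpair_pair]
  induction n with
  | zero => rfl
  | succ n ih => simp only [← ih]; simp

theorem rec_pre (O : Set ℕ) : FunRecIn O (fun l => Encodable.encode (pre O l)) := by
  classical
  have hp : Primrec (fun m : ℕ => Encodable.encode
      (((Encodable.decode m.unpair.1.unpair.2 : Option (List Bool)).getD []) ++
        [decide (m.unpair.2 = 1)])) := by
    refine Primrec.encode.comp (Primrec.list_append.comp ?_ (Primrec.list_cons.comp ?_ (Primrec.const [])))
    · exact Primrec.option_getD.comp (Primrec.decode.comp (Primrec.snd.comp (Primrec.unpair.comp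
        (Primrec.fst.comp Primrec.unpair)))) (Primrec.const [])
    · exact (PrimrecPred.decide (Primrec.eq.comp (Primrec.snd.comp Primrec.unpair) (Primrec.const 1)) :)
  have hg : FunRecIn O (fun m => Encodable.encode
      (((Encodable.decode m.unpair.2 : Option (List Bool)).getD []) ++
        [decide (chi O m.unpair.1 = 1)])) := by
    have := (FunRecIn.prim (O := O) hp).comp ((FunRecIn.prim (O := O) Primrec.id).pair
      (FunRecIn.oracle.comp (FunRecIn.prim (O := O) (Primrec.fst.comp Primrec.unpair))))
    simpa using this
  have := FunRecIn.prec (Encodable.encode ([] : List Bool)) hg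
  convert this using 2 with l
  induction l with
  | zero => simp [pre]
  | succ l ih =>
    simp only [← ih]
    simp only [Nat.unpair_pair, Encodable.encodek, Option.getD_some]
    congr 1
    unfold pre
    rw [List.range_succ, List.map_append]
    congr 1
    simp [chi]

theorem turing_of_red {W O : Set ℕ} (h : Red W O) : TuringLE W O := by
  classical
  obtain ⟨⟨T, hT⟩, hC⟩ := h
  let q : ℕ → Prop := fun m => m.unpair.1.unpair.2.unpair.2 ≤ 1 ∧
    T (((Encodable.decode m.unpair.2 : Option (List Bool)).getD []), (m.unpair.1.unpair.1,
      decide (m.unpair.1.unpair.2.unpair.2 = 1)))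
  have hw : Primrec (fun m : ℕ => m.unpair.1.unpair.1) :=
    Primrec.fst.comp (Primrec.unpair.comp (Primrec.fst.comp Primrec.unpair))
  have hv : Primrec (fun m : ℕ => m.unpair.1.unpair.2.unpair.2) :=
    Primrec.snd.comp (Primrec.unpair.comp (Primrec.snd.comp (Primrec.unpair.comp
      (Primrec.fst.comp Primrec.unpair))))
  have hq : PrimrecPred q := by
    refine PrimrecPred.and (Primrec.nat_le.comp hv (Primrec.const 1)) (hT.comp ?_)
    refine Primrec.pair ?_ (Primrec.pair hw ?_)
    · exact Primrec.option_getD.comp (Primrec.decode.comp (Primrec.snd.comp Primrec.unpair)) (Primrec.const [])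
    · exact (PrimrecPred.decide (Primrec.eq.comp hv (Primrec.const 1)) :)
  have ht : FunRecIn O (fun m => if q m then 0 else 1) :=
    FunRecIn.prim (Primrec.ite hq (Primrec.const 0) (Primrec.const 1))
  have hf := ht.comp ((FunRecIn.prim (O := O) Primrec.id).pair
      ((rec_pre O).comp (FunRecIn.prim (O := O) (Primrec.fst.comp (Primrec.unpair.comp
        (Primrec.snd.comp Primrec.unpair))))))
  have hr := RecursiveIn.rfind hf
  have hres := RecursiveIn.comp (FunRecIn.prim (O := O) (Primrec.snd.comp Primrec.unpair)) hr
  unfold TuringLE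
  refine (congrArg (RecursiveIn _) ?_).mp hres
  funext w
  apply Part.eq_some_iff.2
  have key : ∀ k, (if q (Nat.pair (Nat.pair w k) (Encodable.encode (pre O k.unpair.1))) then 0 else 1) = 0 ↔
      k.unpair.2 ≤ 1 ∧ T (pre O k.unpair.1, (w, decide (k.unpair.2 = 1))) := by
    intro k
    simp only [q, Nat.unpair_pair, Encodable.encodek, Option.getD_some]
    split <;> simp_all
  have hex : ∃ k : ℕ, k.unpair.2 ≤ 1 ∧ T (pre O k.unpair.1, (w, decide (k.unpair.2 = 1))) := by
    obtain ⟨l, hl⟩ := (hC w (val W w)).2 rfl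
    refine ⟨Nat.pair l (if val W w then 1 else 0), ?_⟩
    simp only [Nat.unpair_pair]
    cases hvw : val W w <;> simp_all
  have hk := Nat.find_spec hex
  have hmin := fun m => Nat.find_min (m := m) hex
  set k := Nat.find hex
  refine Part.mem_bind_iff.2 ⟨k, Nat.mem_rfind.2 ⟨?_, ?_⟩, ?_⟩
  · simp only [PFun.coe_val, Part.map_eq_map, Part.map_some, Part.mem_some_iff, id, Nat.unpair_pair]
    exact (decide_eq_true ((key k).2 hk)).symm
  · intro m hm
    simp only [PFun.coe_val, Part.map_eq_map, Part.map_some, Part.mem_some_iff, id, Nat.unpair_pair]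
    exact (decide_eq_false (fun h => hmin m hm ((key m).1 h))).symm
  · have h1 := (hC w _).1 ⟨_, hk.2⟩
    have h2 : chi W w = k.unpair.2 := by
      have := hk.1
      have h3 : k.unpair.2 = 0 ∨ k.unpair.2 = 1 := by omega
      by_cases hw : w ∈ W
      · simp [chi, hw, val] at h1 ⊢; omega
      · simp [chi, hw, val] at h1 ⊢; omega
    simp [h2]

theorem sg_of_rec {O : Set ℕ} {f : ℕ →. ℕ} (h : RecursiveIn (chi O) f) :
    Sg (fun _ : Unit => O) (fun _ (p : ℕ × ℕ) => p.2 ∈ f p.1) := by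
  have heq : ∀ {g : ℕ → ℕ}, Primrec g → Sg (fun _ : Unit => O) (fun _ (p : ℕ × ℕ) => p.2 = g p.1) :=
    fun hg => Sg.prim (Primrec.eq.comp Primrec.snd (hg.comp Primrec.fst))
  induction h with
  | zero => exact (heq (Primrec.const 0)).of_eq fun _ p => by simp [pure, PFun.pure]
  | succ => exact (heq Primrec.succ).of_eq fun _ p => by simp
  | left => exact (heq (Primrec.fst.comp Primrec.unpair)).of_eq fun _ p => by simp
  | right => exact (heq (Primrec.snd.comp Primrec.unpair)).of_eq fun _ p => by simp
  | oracle =>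
    have e : ∀ b : ℕ, PrimrecPred (fun p : ℕ × ℕ => p.2 = b) := fun b =>
      Primrec.eq.comp Primrec.snd (Primrec.const b)
    refine (((Sg.prim (e 1)).and (Sg.mem_self.comp Primrec.fst)).or
      ((Sg.prim (e 0)).and (Sg.not_mem_self.comp Primrec.fst))).of_eq fun _ p => ?_
    by_cases h : p.1 ∈ O <;> simp [chi, h]
  | @pair f g _ _ h1 h2 =>
    have g1 := h1.comp (g := fun q : ((ℕ × ℕ) × ℕ) × ℕ => (q.1.1.1, q.1.2))
      ((Primrec.fst.comp (Primrec.fst.comp Primrec.fst)).pair (Primrec.snd.comp Primrec.fst))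
    have g2 := h2.comp (g := fun q : ((ℕ × ℕ) × ℕ) × ℕ => (q.1.1.1, q.2))
      ((Primrec.fst.comp (Primrec.fst.comp Primrec.fst)).pair Primrec.snd)
    have g3 : PrimrecPred (fun q : ((ℕ × ℕ) × ℕ) × ℕ => Nat.pair q.1.2 q.2 = q.1.1.2) :=
      Primrec.eq.comp (Primrec₂.natPair.comp (Primrec.snd.comp Primrec.fst) Primrec.snd)
        (Primrec.snd.comp (Primrec.fst.comp Primrec.fst))
    refine (g1.and (g2.and (Sg.prim g3))).ex.ex.of_eq fun _ p => ?_
    simp [Seq.seq]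
  | @comp f g _ _ h1 h2 =>
    have g1 := h1.comp (g := fun q : (ℕ × ℕ) × ℕ => (q.2, q.1.2))
      (Primrec.snd.pair (Primrec.snd.comp Primrec.fst))
    have g2 := h2.comp (g := fun q : (ℕ × ℕ) × ℕ => (q.1.1, q.2))
      ((Primrec.fst.comp Primrec.fst).pair Primrec.snd)
    refine (g2.and g1).ex.of_eq fun _ p => ?_
    constructor
    · rintro ⟨b, h1, h2⟩
      exact Part.mem_bind h1 h2
    · intro h
      obtain ⟨b, h1, h2⟩ := Part.mem_bind_iff.1 h
      exact ⟨b, h1, h2⟩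
  | @prec f g _ _ h1 h2 =>
    -- q = (p, L)
    have geti : ∀ {α : Type} [Primcodable α] {L : α → List ℕ} {i v : α → ℕ}, Primrec L → Primrec i →
        Primrec v → PrimrecPred (fun a => (L a)[i a]? = some (v a)) := fun hL hi hv =>
      Primrec.eq.comp (Primrec.list_getElem?.comp hL hi) (Primrec.option_some.comp hv)
    have c1 : Sg (fun _ : Unit => O) (fun _ (q : (ℕ × ℕ) × List ℕ) => ∃ v, q.2[0]? = some v ∧
        v ∈ f q.1.1.unpair.1) := by
      refine Sg.ex (V := fun _ (r : ((ℕ × ℕ) × List ℕ) × ℕ) => r.1.2[0]? = some r.2 ∧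
        r.2 ∈ f r.1.1.1.unpair.1) (Sg.and (Sg.prim (geti (Primrec.snd.comp Primrec.fst)
          (Primrec.const 0) Primrec.snd)) (h1.comp
          (g := fun r : ((ℕ × ℕ) × List ℕ) × ℕ => (r.1.1.1.unpair.1, r.2)) ?_))
      exact (Primrec.fst.comp (Primrec.unpair.comp (Primrec.fst.comp (Primrec.fst.comp Primrec.fst)))).pair
        Primrec.snd
    have c2 : Sg (fun _ : Unit => O) (fun _ (q : (ℕ × ℕ) × List ℕ) => ∀ y ∈ List.range q.1.1.unpair.2,
        ∃ i, ∃ i', q.2[y]? = some i ∧ q.2[y + 1]? = some i' ∧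
        i' ∈ g (Nat.pair q.1.1.unpair.1 (Nat.pair y i))) := by
      refine Sg.ball (V := fun _ (s : ((ℕ × ℕ) × List ℕ) × ℕ) => ∃ i, ∃ i', s.1.2[s.2]? = some i ∧
        s.1.2[s.2 + 1]? = some i' ∧ i' ∈ g (Nat.pair s.1.1.1.unpair.1 (Nat.pair s.2 i))) ?_
        (Primrec.list_range.comp (Primrec.snd.comp (Primrec.unpair.comp (Primrec.fst.comp Primrec.fst))))
      refine Sg.ex (V := fun _ (t : (((ℕ × ℕ) × List ℕ) × ℕ) × ℕ) => ∃ i', t.1.1.2[t.1.2]? = some t.2 ∧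
        t.1.1.2[t.1.2 + 1]? = some i' ∧ i' ∈ g (Nat.pair t.1.1.1.1.unpair.1 (Nat.pair t.1.2 t.2))) ?_
      refine Sg.ex (V := fun _ (t : ((((ℕ × ℕ) × List ℕ) × ℕ) × ℕ) × ℕ) =>
        t.1.1.1.2[t.1.1.2]? = some t.1.2 ∧ t.1.1.1.2[t.1.1.2 + 1]? = some t.2 ∧
         t.2 ∈ g (Nat.pair t.1.1.1.1.1.unpair.1 (Nat.pair t.1.1.2 t.1.2))) ?_
      have pL : Primrec (fun t : ((((ℕ × ℕ) × List ℕ) × ℕ) × ℕ) × ℕ => t.1.1.1.2) :=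
        Primrec.snd.comp (Primrec.fst.comp (Primrec.fst.comp Primrec.fst))
      have py : Primrec (fun t : ((((ℕ × ℕ) × List ℕ) × ℕ) × ℕ) × ℕ => t.1.1.2) :=
        Primrec.snd.comp (Primrec.fst.comp Primrec.fst)
      have pi : Primrec (fun t : ((((ℕ × ℕ) × List ℕ) × ℕ) × ℕ) × ℕ => t.1.2) :=
        Primrec.snd.comp Primrec.fst
      have pa : Primrec (fun t : ((((ℕ × ℕ) × List ℕ) × ℕ) × ℕ) × ℕ => t.1.1.1.1.1.unpair.1) :=
        Primrec.fst.comp (Primrec.unpair.comp (Primrec.fst.comp (Primrec.fst.comp (Primrec.fst.comp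
          (Primrec.fst.comp Primrec.fst)))))
      exact (Sg.prim (geti pL py pi)).and ((Sg.prim (geti pL (Primrec.succ.comp py) Primrec.snd)).and
        (h2.comp (g := fun t : ((((ℕ × ℕ) × List ℕ) × ℕ) × ℕ) × ℕ =>
          (Nat.pair t.1.1.1.1.1.unpair.1 (Nat.pair t.1.1.2 t.1.2), t.2))
          ((Primrec₂.natPair.comp pa (Primrec₂.natPair.comp py pi)).pair Primrec.snd)))
    have c3 : PrimrecPred (fun q : (ℕ × ℕ) × List ℕ => q.2[q.1.1.unpair.2]? = some q.1.2) :=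
      geti Primrec.snd (Primrec.snd.comp (Primrec.unpair.comp (Primrec.fst.comp Primrec.fst)))
        (Primrec.snd.comp Primrec.fst)
    refine (c1.and (c2.and (Sg.prim c3))).ex.of_eq ?_
    rintro _ ⟨m, v⟩
    simp only [Nat.unpaired]
    generalize m.unpair.1 = a
    generalize m.unpair.2 = n
    constructor
    · rintro ⟨L, ⟨v0, h0, h0'⟩, hs, hn⟩
      have : ∀ y ≤ n, ∀ i, L[y]? = some i → i ∈ (Nat.rec (f a) (fun y IH => do
          let i ← IH; g (Nat.pair a (Nat.pair y i))) y : Part ℕ) := by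
        intro y
        induction y with
        | zero =>
          intro _ i hi
          rw [h0] at hi
          obtain rfl := Option.some.inj hi
          exact h0'
        | succ y ih =>
          intro hy i hi
          obtain ⟨j, j', e1, e2, e3⟩ := hs y (List.mem_range.2 hy)
          rw [hi] at e2
          obtain rfl := Option.some.inj e2
          exact Part.mem_bind (ih (by omega) j e1) e3
      exact this n le_rfl v hn
    · intro hv
      suffices ∀ n v, v ∈ (Nat.rec (f a) (fun y IH => do
          let i ← IH; g (Nat.pair a (Nat.pair y i))) n : Part ℕ) → ∃ L : List ℕ, L.length = n + 1 ∧
          (∃ v0, L[0]? = some v0 ∧ v0 ∈ f a) ∧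
          (∀ y < n, ∃ i i', L[y]? = some i ∧ L[y+1]? = some i' ∧ i' ∈ g (Nat.pair a (Nat.pair y i))) ∧
          L[n]? = some v by
        obtain ⟨L, -, e1, e2, e3⟩ := this n v hv
        exact ⟨L, e1, fun y hy => e2 y (List.mem_range.1 hy), e3⟩
      clear hv
      intro n
      induction n with
      | zero => intro v hv; exact ⟨[v], by simp, ⟨v, by simp, hv⟩, by simp, by simp⟩
      | succ n ih =>
        intro v hv
        obtain ⟨i, hi, hvi⟩ := Part.mem_bind_iff.1 hv
        obtain ⟨L, e0, ⟨v0, e1, e1'⟩, e2, e3⟩ := ih i hi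
        have ap : ∀ y ≤ n, (L ++ [v])[y]? = L[y]? := fun y hy =>
          List.getElem?_append_left (by omega)
        have al : (L ++ [v])[n + 1]? = some v := by
          rw [List.getElem?_append_right (by omega)]; simp [e0]
        refine ⟨L ++ [v], by simp [e0], ⟨v0, by rw [ap 0 (by omega), e1], e1'⟩, ?_, al⟩
        intro y hy
        by_cases hyn : y = n
        · subst hyn
          exact ⟨i, v, by rw [ap y le_rfl, e3], al, hvi⟩
        · obtain ⟨j, j', q1, q2, q3⟩ := e2 y (by omega)
          exact ⟨j, j', by rw [ap y (by omega), q1], by rw [ap _ (by omega), q2], q3⟩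
  | @rfind f _ h1 =>
    have g1 := h1.comp (g := fun p : ℕ × ℕ => (Nat.pair p.1 p.2, 0))
      ((Primrec₂.natPair.comp Primrec.fst Primrec.snd).pair (Primrec.const 0))
    have g2 : Sg (fun _ : Unit => O) (fun _ (p : ℕ × ℕ) => ∀ m ∈ List.range p.2, ∃ k, ¬ k = 0 ∧
        k ∈ f (Nat.pair p.1 m)) := by
      refine Sg.ball (V := fun _ (q : (ℕ × ℕ) × ℕ) => ∃ k, ¬ k = 0 ∧ k ∈ f (Nat.pair q.1.1 q.2)) ?_
        (Primrec.list_range.comp Primrec.snd)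
      refine Sg.ex (V := fun _ (q : ((ℕ × ℕ) × ℕ) × ℕ) => ¬ q.2 = 0 ∧
        q.2 ∈ f (Nat.pair q.1.1.1 q.1.2)) ?_
      refine Sg.and (Sg.prim (PrimrecPred.not (Primrec.eq.comp Primrec.snd (Primrec.const 0)))) ?_
      exact h1.comp (g := fun q : ((ℕ × ℕ) × ℕ) × ℕ => (Nat.pair q.1.1.1 q.1.2, q.2))
        ((Primrec₂.natPair.comp (Primrec.fst.comp (Primrec.fst.comp Primrec.fst))
          (Primrec.snd.comp Primrec.fst)).pair Primrec.snd)
    refine (g1.and g2).of_eq fun _ p => ?_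
    refine Iff.trans ?_ Nat.mem_rfind.symm
    simp only [Part.map_eq_map, Part.mem_map_iff, List.mem_range]
    constructor
    · rintro ⟨h, h'⟩
      refine ⟨⟨0, h, by simp⟩, fun {m} hm => ?_⟩
      obtain ⟨k, hk, hkf⟩ := h' m hm
      exact ⟨k, hkf, by simp [hk]⟩
    · rintro ⟨⟨k, hk, hk0⟩, h'⟩
      have : k = 0 := by simpa using hk0
      subst this
      refine ⟨hk, fun m hm => ?_⟩
      obtain ⟨k, hk, hk0⟩ := h' hm
      exact ⟨k, by simpa using hk0, hk⟩

theorem sg_of_fun {O : Set ℕ} {f : ℕ → ℕ} (h : FunRecIn O f) :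
    Sg (fun _ : Unit => O) (fun _ (p : ℕ × ℕ) => p.2 = f p.1) :=
  (sg_of_rec h).of_eq fun _ p => by simp

theorem red_of_turing {W O : Set ℕ} (h : TuringLE W O) : Red W O := by
  apply red_of_sg
  have h1 := (sg_of_fun h).comp (g := fun p : ℕ × Bool => (p.1, bif p.2 then 1 else 0))
    (Primrec.fst.pair (Primrec.cond Primrec.snd (Primrec.const 1) (Primrec.const 0)))
  refine h1.of_eq ?_
  rintro _ ⟨w, v⟩
  by_cases hw : w ∈ W <;> cases v <;> simp [chi, val, hw]

/-- same-colour relation on decreasing lists -/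
def Bf (n : ℕ) (F : ℕ → ℕ) (u v : List ℕ) : Prop :=
  (dec u ∧ dec v ∧ u.length = n + 4 ∧ v.length = n + 4 ∧ u ≠ v) ∧
    F (Encodable.encode u.reverse) = F (Encodable.encode v.reverse)

/-- its code -/
def bf (n : ℕ) (F : ℕ → ℕ) : Set ℕ :=
  {m | Bf n F ((Encodable.decode m : Option (List ℕ × List ℕ)).getD ([], [])).1
    ((Encodable.decode m : Option (List ℕ × List ℕ)).getD ([], [])).2}

theorem rel_bf (n : ℕ) (F : ℕ → ℕ) : rel (bf n F) = Bf n F := by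
  funext u v
  simp [rel, bf]

theorem dc_feq {Z : Set ℕ} {F : ℕ → ℕ} (h : FunRecIn Z F) :
    Dc (fun _ : Unit => Z) (fun _ (p : ℕ × ℕ) => F p.1 = F p.2) := by
  have h1 := sg_of_fun h
  constructor
  · have g1 := h1.comp (g := fun q : (ℕ × ℕ) × ℕ => (q.1.1, q.2))
      ((Primrec.fst.comp Primrec.fst).pair Primrec.snd)
    have g2 := h1.comp (g := fun q : (ℕ × ℕ) × ℕ => (q.1.2, q.2))
      ((Primrec.snd.comp Primrec.fst).pair Primrec.snd)
    refine (g1.and g2).ex.of_eq fun _ p => ?_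
    simp
  · have g1 := h1.comp (g := fun q : ((ℕ × ℕ) × ℕ) × ℕ => (q.1.1.1, q.1.2))
      ((Primrec.fst.comp (Primrec.fst.comp Primrec.fst)).pair (Primrec.snd.comp Primrec.fst))
    have g2 := h1.comp (g := fun q : ((ℕ × ℕ) × ℕ) × ℕ => (q.1.1.2, q.2))
      ((Primrec.snd.comp (Primrec.fst.comp Primrec.fst)).pair Primrec.snd)
    have g3 : PrimrecPred (fun q : ((ℕ × ℕ) × ℕ) × ℕ => ¬ q.1.2 = q.2) :=
      PrimrecPred.not (Primrec.eq.comp (Primrec.snd.comp Primrec.fst) Primrec.snd)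
    refine (g1.and (g2.and (Sg.prim g3))).ex.ex.of_eq fun _ p => ?_
    simp

theorem dc_bf (n : ℕ) {Z : Set ℕ} {F : ℕ → ℕ} (h : FunRecIn Z F) :
    Dc (fun _ : Unit => Z) (fun _ m => m ∈ bf n F) := by
  have hB : Dc (fun _ : Unit => Z) (fun _ (p : List ℕ × List ℕ) => Bf n F p.1 p.2) := by
    have e := (dc_feq h).comp (g := fun p : List ℕ × List ℕ =>
      (Encodable.encode p.1.reverse, Encodable.encode p.2.reverse))
      ((Primrec.encode.comp (Primrec.list_reverse.comp Primrec.fst)).pair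
        (Primrec.encode.comp (Primrec.list_reverse.comp Primrec.snd)))
    have q : PrimrecPred (fun p : List ℕ × List ℕ => dec p.1 ∧ dec p.2 ∧ p.1.length = n + 4 ∧
        p.2.length = n + 4 ∧ ¬ p.1 = p.2) :=
      (primrec_dec.comp Primrec.fst).and ((primrec_dec.comp Primrec.snd).and
        ((Primrec.eq.comp (Primrec.list_length.comp Primrec.fst) (Primrec.const _)).and
        ((Primrec.eq.comp (Primrec.list_length.comp Primrec.snd) (Primrec.const _)).and
        (PrimrecPred.not (Primrec.eq.comp Primrec.fst Primrec.snd)))))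
    exact (Dc.prim q).and e
  exact hB.comp (g := fun m => (Encodable.decode m : Option (List ℕ × List ℕ)).getD ([], []))
    (Primrec.option_getD.comp Primrec.decode (Primrec.const _))

theorem dec_strictMono {k : ℕ} {u : List ℕ} (hu : dec u) (hk : u.length = k) :
    ∃ s : Fin k → ℕ, StrictMono s ∧ List.ofFn s = u.reverse := by
  subst hk
  have hp : u.reverse.Pairwise (· < ·) := List.pairwise_reverse.2 hu
  refine ⟨fun i => u.reverse[(i : ℕ)]'(by simp), ?_, ?_⟩
  · intro i j hij
    exact List.pairwise_iff_getElem.1 hp _ _ (by simp) (by simp) hij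
  · apply List.ext_getElem
    · simp
    · intro i h1 h2
      simp

theorem strictMono_dec {k : ℕ} {s : Fin k → ℕ} (hs : StrictMono s) : dec (List.ofFn s).reverse := by
  unfold dec
  rw [List.pairwise_reverse, List.pairwise_ofFn]
  exact fun i j hij => hs hij

theorem mt_bf {n : ℕ} {F : ℕ → ℕ} {f : (Fin (n + 4) → ℕ) → ℕ} (hb : Bounded2Tuples (n + 4) f)
    (hF : ∀ s : Fin (n + 4) → ℕ, StrictMono s → F (Encodable.encode (List.ofFn s)) = f s) :
    Mt (Bf n F) := by
  have sym : ∀ u v, Bf n F u v → Bf n F v u := fun u v h =>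
    ⟨⟨h.1.2.1, h.1.1, h.1.2.2.2.1, h.1.2.2.1, h.1.2.2.2.2.symm⟩, h.2.symm⟩
  intro u v w h1 h2
  replace h1 : Bf n F u v := h1.elim id (sym _ _)
  replace h2 : Bf n F u w := h2.elim id (sym _ _)
  by_contra hvw
  obtain ⟨⟨du, dv, lu, lv, nuv⟩, e1⟩ := h1
  obtain ⟨⟨-, dw, -, lw, nuw⟩, e2⟩ := h2
  obtain ⟨s, ms, hs⟩ := dec_strictMono du lu
  obtain ⟨t, mt, ht⟩ := dec_strictMono dv lv
  obtain ⟨r, mr, hr⟩ := dec_strictMono dw lw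
  rw [← hs, ← ht, hF _ ms, hF _ mt] at e1
  rw [← hs, ← hr, hF _ ms, hF _ mr] at e2
  have inj : ∀ {a b : List ℕ} {x y : Fin (n + 4) → ℕ}, List.ofFn x = a.reverse →
      List.ofFn y = b.reverse → a ≠ b → x ≠ y := by
    rintro a b x y h1 h2 h rfl
    exact h (List.reverse_injective (h1.symm.trans h2))
  have hsub : ({s, t, r} : Set (Fin (n + 4) → ℕ)) ⊆ {x | StrictMono x ∧ f x = f s} := by
    rintro x (rfl | rfl | rfl)
    · exact ⟨ms, rfl⟩
    · exact ⟨mt, e1.symm⟩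
    · exact ⟨mr, e2.symm⟩
  have h3 : ({s, t, r} : Set (Fin (n + 4) → ℕ)).encard = 3 :=
    Set.encard_eq_three.2 ⟨s, t, r, inj hs ht nuv, inj hs hr nuw, inj ht hr hvw, rfl⟩
  have := (Set.encard_le_encard hsub).trans (hb (f s))
  rw [h3] at this
  exact absurd this (by decide)

theorem tail_eq {n : ℕ} {s t : Fin (n + 4) → ℕ}
    (h : (List.ofFn s).reverse.take 3 = (List.ofFn t).reverse.take 3) (m : ℕ) (hm : m < n + 4)
    (hn : n + 1 ≤ m) : s ⟨m, hm⟩ = t ⟨m, hm⟩ := by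
  have key : ∀ x : Fin (n + 4) → ℕ, ((List.ofFn x).reverse.take 3)[n + 3 - m]? =
      some (x ⟨m, hm⟩) := by
    intro x
    rw [List.getElem?_take_of_lt (by omega), List.getElem?_reverse (by rw [List.length_ofFn]; omega)]
    rw [List.getElem?_ofFn]
    have : (List.ofFn x).length - 1 - (n + 3 - m) = m := by simp; omega
    simp only [this]
    rw [dif_pos hm]
  have h1 := key s
  rw [h, key t] at h1
  exact (Option.some.inj h1).symm

/-- suppose `W ≰_T Z`, `n ∈ ℕ`, and `f` is a 2-bounded coloring of
`[ℕ]^(n+4)` computable relative to an oracle for `Z` (via the standard coding of tuples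
as naturals). Then there is an infinite 3-tail `f`-rainbow `X` with `W ≰_T X ⊕ Z`:
tuples from `X` whose last three coordinates differ get distinct colors. -/
theorem statement14 (W Z : Set ℕ) (hWZ : ¬ TuringLE W Z) (n : ℕ)
    (f : (Fin (n + 4) → ℕ) → ℕ) (hbounded : Bounded2Tuples (n + 4) f)
    (hcomp : ∃ F : ℕ → ℕ, FunRecIn Z F ∧ ∀ s : Fin (n + 4) → ℕ, StrictMono s →
      F (Encodable.encode (List.ofFn s)) = f s) :
    ∃ X : Set ℕ, X.Infinite ∧
      (∀ s t : Fin (n + 4) → ℕ, StrictMono s → StrictMono t →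
        (∀ i, s i ∈ X) → (∀ i, t i ∈ X) →
        (fun i : Fin 3 => s ⟨n + 1 + (i : ℕ), by have := i.isLt; omega⟩)
          ≠ (fun i : Fin 3 => t ⟨n + 1 + (i : ℕ), by have := i.isLt; omega⟩) →
        f s ≠ f t) ∧
      ¬ TuringLE W (join X Z) := by
  obtain ⟨F, hFr, hF⟩ := hcomp
  have hZ : ¬ Red W Z := fun h => hWZ (turing_of_red h)
  have hbZ : Dc (fun _ : Unit => Z) (fun _ m => m ∈ join (bf n F) Z) :=
    Dc.join' (A := fun _ => bf n F) (B := fun _ => Z) (dc_bf n hFr) Dc.self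
  have hu : Dc (fun _ : Unit => Z) (fun _ m => m ∈ (Set.univ : Set ℕ)) :=
    (Dc.prim (p := fun m : ℕ => m = m) (Primrec.eq.comp Primrec.id Primrec.id)).of_eq
      fun _ m => by simp
  have hg : gr W (join (bf n F) Z) Set.univ := ⟨Set.infinite_univ, red_mono hu hbZ hZ⟩
  obtain ⟨X, -, ⟨hXi, hXr⟩, hrb⟩ := NS_three W Z (bf n F) [] Set.univ
    (by rw [rel_bf]; exact mt_bf hbounded hF) dec_nil (by simp) hg
    (by
      intro c _ u v hu hv hu' hv' huv
      rw [rel_bf] at huv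
      exfalso
      have h1 := huv.1.2.2.1
      rcases u with _ | ⟨a, _ | ⟨a', u⟩⟩
      · simp at h1
      · simp at h1
      · have e1 := hu' a (by simp)
        have e2 := hu' a' (by simp)
        have := (dec_cons.1 hu).1 a' (by simp)
        simp [fs] at e1 e2
        omega) (Or.inr rfl)
  refine ⟨X, hXi, ?_, ?_⟩
  · intro s t hs ht hsX htX hne hst
    apply hne
    funext i
    refine tail_eq ?_ _ _ (Nat.le_add_right _ _)
    by_cases hd : s = t
    · rw [hd]
    · apply hrb _ _ (strictMono_dec hs) (strictMono_dec ht)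
      · intro a ha
        obtain ⟨i, rfl⟩ := (List.mem_ofFn' _ _).1 (List.mem_reverse.1 ha)
        exact Or.inr (hsX i)
      · intro a ha
        obtain ⟨i, rfl⟩ := (List.mem_ofFn' _ _).1 (List.mem_reverse.1 ha)
        exact Or.inr (htX i)
      · rw [rel_bf]
        refine ⟨⟨strictMono_dec hs, strictMono_dec ht, by simp, by simp, fun h => hd ?_⟩, ?_⟩
        · exact List.ofFn_injective (List.reverse_injective h)
        · simp only [List.reverse_reverse, hF _ hs, hF _ ht, hst]
  · intro h
    have h0 := Dc.self (o := fun _ : Unit => join X (join (bf n F) Z))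
    refine hXr ((red_of_turing h).trans (Dc.join' (A := fun _ => X) (B := fun _ => Z) ?_ ?_))
    · exact Dc.left (A := fun _ => X) (B := fun _ => join (bf n F) Z) h0
    · exact Dc.right (A := fun _ => bf n F) (B := fun _ => Z)
        (Dc.right (A := fun _ => X) (B := fun _ => join (bf n F) Z) h0)

end RRT
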